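/- arXiv:0811.2735 — 6 statements merged into one kernel-verified Lean document; each statement's English description precedes it below -/
import Mathlib

section
/- Assume β_n → β and h_n → h with β, h ≥ 0. Then the empirical vector N/n ∈ Ω, distributed under μ_{β_n,h_n,n}, satisfies a large deviation principle with speed n and good rate function I = f_{β,h} − min_Ω f_{β,h}; concretely: for every closed set F ⊆ Ω, limsup_{n→∞} (1/n) log μ_{β_n,h_n,n}(N/n ∈ F) ≤ −inf_{x∈F} I(x), and for every relatively open set G ⊆ Ω, liminf_{n→∞} (1/n) log μ_{β_n,h_n,n}(N/n ∈ G) ≥ −inf_{x∈G} I(x). -/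
open Real Filter Finset Topology MeasureTheory

/-- The simplex `Ω = {x ∈ ℝ^q : x_1 + ⋯ + x_q = 1, x_i ≥ 0}`. -/
def simplex (q : ℕ) : Set (Fin q → ℝ) := {x | (∀ i, 0 ≤ x i) ∧ ∑ i, x i = 1}

/-- The Curie–Weiss Potts free energy
`f_{β,h}(x) = ∑ x_i log x_i − (β/2) ∑ x_i² − h x_1` (with `0 log 0 = 0`). -/
noncomputable def freeEnergy (q : ℕ) [NeZero q] (β h : ℝ) (x : Fin q → ℝ) : ℝ :=
  ∑ i, x i * Real.log (x i) - β / 2 * ∑ i, x i ^ 2 - h * x 0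

/-- Boltzmann weight of a spin configuration `σ : Fin n → Fin q`:
`exp((β/n) ∑_{i<j} δ_{σ_i,σ_j} + h ∑_i δ_{σ_i,1})`. -/
noncomputable def cwWeight (q n : ℕ) [NeZero q] (β h : ℝ) (σ : Fin n → Fin q) : ℝ :=
  Real.exp (β / n *
      ∑ p ∈ Finset.univ.filter (fun p : Fin n × Fin n => p.1 < p.2),
        (if σ p.1 = σ p.2 then (1 : ℝ) else 0)
    + h * ∑ i, (if σ i = 0 then (1 : ℝ) else 0))

/-- The partition function `Z_{β,h,n}`. -/
noncomputable def cwZ (q n : ℕ) [NeZero q] (β h : ℝ) : ℝ :=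
  ∑ σ : Fin n → Fin q, cwWeight q n β h σ

/-- The empirical color count `N_k(σ) = #{i : σ_i = k}`. -/
def colorCount {q n : ℕ} (σ : Fin n → Fin q) (k : Fin q) : ℕ :=
  (Finset.univ.filter (fun i => σ i = k)).card

/-- Probability of an event under the Curie–Weiss Potts measure `μ_{β,h,n}`. -/
noncomputable def cwProb (q n : ℕ) [NeZero q] (β h : ℝ) (A : Set (Fin n → Fin q)) : ℝ :=
  (∑ σ : Fin n → Fin q, Set.indicator A (cwWeight q n β h) σ) / cwZ q n β h

/-- Expectation of an observable under the Curie–Weiss Potts measure `μ_{β,h,n}`. -/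
noncomputable def cwExp (q n : ℕ) [NeZero q] (β h : ℝ) (g : (Fin n → Fin q) → ℝ) : ℝ :=
  (∑ σ : Fin n → Fin q, cwWeight q n β h σ * g σ) / cwZ q n β h

/-- The rate function `I = f_{β,h} − min_Ω f_{β,h}`. -/
noncomputable def rateI (q : ℕ) [NeZero q] (β h : ℝ) (x : Fin q → ℝ) : ℝ :=
  freeEnergy q β h x - sInf (freeEnergy q β h '' simplex q)

/-- The empirical distribution `N/n` of a configuration. -/
noncomputable def empirical {q n : ℕ} (σ : Fin n → Fin q) : Fin q → ℝ :=
  fun k => (colorCount σ k : ℝ) / n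

lemma sum_colorCount {q n : ℕ} (σ : Fin n → Fin q) : ∑ k, colorCount σ k = n := by
  have := Finset.card_eq_sum_card_fiberwise (f := σ) (s := univ) (t := univ) (by simp)
  simpa [colorCount] using this.symm

lemma colorCount_le {q n : ℕ} (σ : Fin n → Fin q) (k : Fin q) : colorCount σ k ≤ n := by
  simpa [colorCount] using Finset.card_filter_le (univ : Finset (Fin n)) (fun i => σ i = k)

lemma mul_empirical {q n : ℕ} (σ : Fin n → Fin q) (k : Fin q) :
    (n : ℝ) * empirical σ k = colorCount σ k := by
  rcases Nat.eq_zero_or_pos n with rfl | hn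
  · simp [colorCount]
  · rw [empirical, mul_div_cancel₀]
    positivity

lemma div_mem_simplex {q n : ℕ} (hn : 0 < n) {N : Fin q → ℕ} (hN : ∑ k, N k = n) :
    (fun k => (N k : ℝ) / n) ∈ simplex q := by
  refine ⟨fun k => by positivity, ?_⟩
  rw [← Finset.sum_div, ← Nat.cast_sum, hN]
  field_simp

lemma empirical_mem_simplex {q n : ℕ} (hn : 0 < n) (σ : Fin n → Fin q) :
    empirical σ ∈ simplex q :=
  div_mem_simplex hn (sum_colorCount σ)

lemma sum_pairs_eq {q n : ℕ} (σ : Fin n → Fin q) :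
    ∑ p ∈ Finset.univ.filter (fun p : Fin n × Fin n => p.1 < p.2),
      (if σ p.1 = σ p.2 then (1 : ℝ) else 0) = (∑ k, (colorCount σ k : ℝ) ^ 2 - n) / 2 := by
  set g : Fin n × Fin n → ℝ := fun p => if σ p.1 = σ p.2 then (1 : ℝ) else 0 with hg
  have hall : ∑ p, g p = ∑ k, (colorCount σ k : ℝ) ^ 2 := by
    have hcard : ∀ k, (colorCount σ k : ℝ) = ∑ i, if σ i = k then (1 : ℝ) else 0 := by
      intro k
      simp [colorCount]
    simp_rw [hcard, sq, Finset.sum_mul_sum, Fintype.sum_prod_type]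
    rw [Finset.sum_comm (s := univ (α := Fin q))]
    refine Finset.sum_congr rfl fun i _ => ?_
    rw [Finset.sum_comm]
    refine Finset.sum_congr rfl fun j _ => ?_
    simp [hg]
  have hsplit : ∑ p, g p = ∑ p with p.1 < p.2, g p + (∑ p with p.1 = p.2, g p +
      ∑ p with p.2 < p.1, g p) := by
    simp_rw [Finset.sum_filter, ← Finset.sum_add_distrib]
    refine Finset.sum_congr rfl fun p _ => ?_
    rcases lt_trichotomy p.1 p.2 with h | h | h
    · simp [h, h.ne, h.le]
    · simp [h]
    · simp [h, h.ne', h.le]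
  have hdiag : ∑ p with p.1 = p.2, g p = n := by
    rw [Finset.sum_filter, Fintype.sum_prod_type]
    simp [hg]
  have hsymm : ∑ p with p.2 < p.1, g p = ∑ p with p.1 < p.2, g p := by
    refine Finset.sum_equiv (Equiv.prodComm _ _) (by simp) ?_
    intro p _
    simp [hg, eq_comm]
  rw [hsymm, hdiag, hall] at hsplit
  linarith

lemma cwWeight_eq {q n : ℕ} [NeZero q] (hn : 0 < n) (β h : ℝ) (σ : Fin n → Fin q) :
    cwWeight q n β h σ = Real.exp (n * (β / 2 * ∑ k, empirical σ k ^ 2 + h * empirical σ 0)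
      - β / 2) := by
  have h0 : ∑ i, (if σ i = 0 then (1 : ℝ) else 0) = colorCount σ 0 := by simp [colorCount]
  rw [cwWeight, sum_pairs_eq, h0]
  congr 1
  simp_rw [empirical, div_pow, ← Finset.sum_div]
  field_simp
  ring

/-- Configurations sharing the colour counts `N`. -/
def typeClass {q : ℕ} (n : ℕ) (N : Fin q → ℕ) : Finset (Fin n → Fin q) :=
  univ.filter fun σ => colorCount σ = N

lemma typeClass_card_mul_exp_le {q n : ℕ} (σ : Fin n → Fin q) :
    ((typeClass n (colorCount σ)).card : ℝ) *
      Real.exp (n * ∑ k, empirical σ k * Real.log (empirical σ k)) ≤ 1 := by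
  rcases Nat.eq_zero_or_pos n with rfl | hn
  · simpa using (typeClass 0 (colorCount σ)).card_le_univ.trans (by simp)
  have hx := empirical_mem_simplex hn σ
  set x := empirical σ with hxdef
  have htot : ∑ τ : Fin n → Fin q, ∏ i, x (τ i) = 1 := by
    have := Finset.sum_prod_piFinset (ι := Fin n) (univ : Finset (Fin q)) (fun _ k => x k)
    simpa [hx.2] using this
  have hprod : ∀ τ ∈ typeClass n (colorCount σ),
      ∏ i, x (τ i) = Real.exp (n * ∑ k, x k * Real.log (x k)) := by
    intro τ hτ
    have hτ' : colorCount τ = colorCount σ := by simpa [typeClass] using hτ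
    have h1 : ∏ i, x (τ i) = ∏ k, x k ^ colorCount τ k := by
      rw [← Finset.prod_fiberwise' univ τ x]
      simp [colorCount]
    rw [h1, hτ', Finset.mul_sum, Real.exp_sum]
    refine Finset.prod_congr rfl fun k _ => ?_
    rw [← mul_assoc, hxdef, mul_empirical, ← hxdef]
    rcases (hx.1 k).eq_or_lt with h | h
    · have : (colorCount σ k : ℝ) = 0 := by rw [← mul_empirical, ← hxdef, ← h, mul_zero]
      have h' : colorCount σ k = 0 := by exact_mod_cast this
      simp [h']
    · rw [mul_comm, Real.exp_mul, Real.exp_log h, Real.rpow_natCast]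
  calc _ = ∑ τ ∈ typeClass n (colorCount σ), ∏ i, x (τ i) := by
        rw [Finset.sum_congr rfl hprod, Finset.sum_const, nsmul_eq_mul]
    _ ≤ ∑ τ : Fin n → Fin q, ∏ i, x (τ i) :=
        Finset.sum_le_sum_of_subset_of_nonneg (Finset.subset_univ _)
          fun τ _ _ => Finset.prod_nonneg fun i _ => hx.1 _
    _ = 1 := htot

lemma factorial_le_typeClass_card_mul {q n : ℕ} (σ : Fin n → Fin q) :
    n.factorial ≤ (typeClass n (colorCount σ)).card * ∏ k, (colorCount σ k).factorial := by
  have hmaps : ∀ g ∈ (univ : Finset (Equiv.Perm (Fin n))),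
      σ ∘ g ∈ typeClass n (colorCount σ) := by
    intro g _
    simp only [typeClass, Finset.mem_filter, Finset.mem_univ, true_and]
    funext k
    exact Finset.card_equiv g (by simp)
  have hfib : ∀ τ ∈ typeClass n (colorCount σ),
      (univ.filter fun g : Equiv.Perm (Fin n) => σ ∘ g = τ).card ≤
        ∏ k, (colorCount σ k).factorial := by
    intro τ _
    rcases (univ.filter fun g : Equiv.Perm (Fin n) => σ ∘ g = τ).eq_empty_or_nonempty with h | h
    · simp [h]
    obtain ⟨g₀, hg₀⟩ := h
    have hg₀ : σ ∘ g₀ = τ := by simpa using hg₀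
    have hst := DomMulAct.stabilizer_card σ
    simp only [Fintype.card_subtype] at hst
    rw [show ∏ k, (colorCount σ k).factorial = _ from hst.symm]
    refine Finset.card_le_card_of_injOn (fun g => g * g₀⁻¹) ?_ (fun a _ b _ h => by simpa using h)
    intro g hg
    have hg : σ ∘ g = τ := by simpa using hg
    simp only [Finset.coe_filter, Finset.mem_univ, true_and, Set.mem_ofPred_eq]
    funext i
    have := congrFun (hg.trans hg₀.symm) (g₀⁻¹ i)
    simpa using this
  have := Finset.card_le_mul_card_image_of_maps_to hmaps _ hfib
  rw [Finset.card_univ, Fintype.card_perm, Fintype.card_fin] at this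
  rwa [mul_comm]

lemma le_log_factorial (n : ℕ) : (n : ℝ) * Real.log n - n ≤ Real.log n.factorial := by
  rcases Nat.eq_zero_or_pos n with rfl | hn
  · simp
  have h := Real.pow_div_factorial_le_exp (n : ℝ) (by positivity) n
  have h' := Real.log_le_log (by positivity) h
  rw [Real.log_div (by positivity) (by positivity), Real.log_pow, Real.log_exp] at h'
  linarith

lemma log_factorial_le {m : ℕ} (hm : 1 ≤ m) :
    Real.log m.factorial ≤ (m : ℝ) * Real.log m - m + 1 + Real.log m := by
  induction m, hm using Nat.le_induction with
  | base => simp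
  | succ m hm ih =>
    have hm0 : (0 : ℝ) < m := by exact_mod_cast hm
    have h := Real.one_sub_inv_le_log_of_pos (show 0 < ((m : ℝ) + 1) / m by positivity)
    rw [Real.log_div (by positivity) (by positivity), inv_div] at h
    have h2 : 1 ≤ ((m : ℝ) + 1) * (Real.log (m + 1) - Real.log m) := by
      calc (1 : ℝ) = (m + 1) * (1 - m / (m + 1)) := by field_simp; ring
        _ ≤ _ := by gcongr
    rw [Nat.factorial_succ]
    push_cast
    rw [Real.log_mul (by positivity) (by positivity)]
    linarith

lemma log_factorial_le_of_le {m n : ℕ} (hmn : m ≤ n) :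
    Real.log m.factorial ≤ (m : ℝ) * Real.log m - m + 1 + Real.log (n + 1) := by
  rcases Nat.eq_zero_or_pos m with rfl | hm
  · have := Real.log_nonneg (show (1 : ℝ) ≤ n + 1 by simp)
    simp
    linarith
  · refine (log_factorial_le hm).trans ?_
    gcongr
    have : (m : ℝ) ≤ n := by exact_mod_cast hmn
    linarith

lemma le_log_typeClass_card {q n : ℕ} (hn : 0 < n) (σ : Fin n → Fin q) :
    -(n * ∑ k, empirical σ k * Real.log (empirical σ k)) - q * (1 + Real.log (n + 1)) ≤
      Real.log (typeClass n (colorCount σ)).card := by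
  have hcard : 0 < (typeClass n (colorCount σ)).card :=
    Finset.card_pos.mpr ⟨σ, by simp [typeClass]⟩
  have h := factorial_le_typeClass_card_mul σ
  have h' : (n.factorial : ℝ) ≤
      (typeClass n (colorCount σ)).card * ∏ k, ((colorCount σ k).factorial : ℝ) := by
    exact_mod_cast h
  have hlog := Real.log_le_log (by positivity) h'
  rw [Real.log_mul (by positivity) (by positivity), Real.log_prod (fun k _ => by positivity)]
    at hlog
  have hup : ∑ k, Real.log ((colorCount σ k).factorial : ℝ) ≤
      ∑ k, ((colorCount σ k : ℝ) * Real.log (colorCount σ k) - colorCount σ k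
        + (1 + Real.log (n + 1))) :=
    Finset.sum_le_sum fun k _ => by
      have := log_factorial_le_of_le (colorCount_le σ k)
      linarith
  have hsum : ∑ k, (colorCount σ k : ℝ) = n := by exact_mod_cast sum_colorCount σ
  rw [Finset.sum_add_distrib, Finset.sum_sub_distrib, hsum] at hup
  simp only [Finset.sum_const, Finset.card_univ, Fintype.card_fin, nsmul_eq_mul] at hup
  have hent : (n : ℝ) * ∑ k, empirical σ k * Real.log (empirical σ k) =
      ∑ k, (colorCount σ k : ℝ) * Real.log (colorCount σ k) - n * Real.log n := by
    rw [Finset.mul_sum]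
    nth_rewrite 2 [← hsum]
    rw [Finset.sum_mul, ← Finset.sum_sub_distrib]
    refine Finset.sum_congr rfl fun k _ => ?_
    rw [← mul_assoc, mul_empirical]
    rcases Nat.eq_zero_or_pos (colorCount σ k) with h0 | h0
    · simp [h0]
    · rw [empirical, Real.log_div (by positivity) (by positivity)]
      ring
  have := le_log_factorial n
  linarith

/-- The unnormalised Curie–Weiss Potts mass of an event. -/
noncomputable def cwMass (q n : ℕ) [NeZero q] (β h : ℝ) (A : Set (Fin n → Fin q)) : ℝ :=
  ∑ σ : Fin n → Fin q, Set.indicator A (cwWeight q n β h) σ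

lemma cwWeight_pos {q n : ℕ} [NeZero q] (β h : ℝ) (σ : Fin n → Fin q) :
    0 < cwWeight q n β h σ :=
  Real.exp_pos _

lemma cwMass_mono {q n : ℕ} [NeZero q] (β h : ℝ) {A B : Set (Fin n → Fin q)} (hAB : A ⊆ B) :
    cwMass q n β h A ≤ cwMass q n β h B :=
  Finset.sum_le_sum fun σ _ => Set.indicator_le_indicator_of_subset hAB
    (fun _ => (cwWeight_pos β h _).le) σ

lemma sum_typeClass_cwWeight {q n : ℕ} [NeZero q] (hn : 0 < n) (β h : ℝ) (σ : Fin n → Fin q) :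
    ∑ τ ∈ typeClass n (colorCount σ), cwWeight q n β h τ =
      (typeClass n (colorCount σ)).card *
        Real.exp (n * ∑ k, empirical σ k * Real.log (empirical σ k)) *
        Real.exp (-(n * freeEnergy q β h (empirical σ)) - β / 2) := by
  have hconst : ∀ τ ∈ typeClass n (colorCount σ),
      cwWeight q n β h τ = cwWeight q n β h σ := by
    intro τ hτ
    have hτ' : colorCount τ = colorCount σ := by simpa [typeClass] using hτ
    have hemp : empirical τ = empirical σ := by
      unfold empirical
      rw [hτ']
    rw [cwWeight_eq hn, cwWeight_eq hn, hemp]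
  rw [Finset.sum_congr rfl hconst, Finset.sum_const, nsmul_eq_mul, mul_assoc, ← Real.exp_add,
    cwWeight_eq hn, freeEnergy]
  congr 2
  ring

lemma cwMass_le {q n : ℕ} [NeZero q] (hn : 0 < n) {β h c : ℝ} {A : Set (Fin n → Fin q)}
    (hc : ∀ σ ∈ A, c ≤ freeEnergy q β h (empirical σ)) :
    cwMass q n β h A ≤ ((n : ℝ) + 1) ^ q * Real.exp (-(n * c) - β / 2) := by
  have hmaps : ∀ σ ∈ (univ : Finset (Fin n → Fin q)),
      colorCount σ ∈ Fintype.piFinset fun _ : Fin q => Finset.range (n + 1) := by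
    intro σ _
    simpa [Fintype.mem_piFinset, Nat.lt_succ_iff] using colorCount_le σ
  rw [cwMass, ← Finset.sum_fiberwise_of_maps_to hmaps]
  have hfib : ∀ N ∈ Fintype.piFinset fun _ : Fin q => Finset.range (n + 1),
      ∑ σ with colorCount σ = N, Set.indicator A (cwWeight q n β h) σ ≤
        Real.exp (-(n * c) - β / 2) := by
    intro N _
    by_cases hN : ∃ σ ∈ A, colorCount σ = N
    · obtain ⟨σ, hσ, rfl⟩ := hN
      calc _ ≤ ∑ τ ∈ typeClass n (colorCount σ), cwWeight q n β h τ :=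
            Finset.sum_le_sum fun τ _ =>
              Set.indicator_le_self' (fun _ _ => (cwWeight_pos β h _).le) τ
        _ ≤ 1 * Real.exp (-(n * c) - β / 2) := by
            rw [sum_typeClass_cwWeight hn]
            gcongr
            · exact typeClass_card_mul_exp_le σ
            · exact hc σ hσ
        _ = _ := one_mul _
    · push Not at hN
      rw [Finset.sum_eq_zero]
      · positivity
      · intro σ hσ
        exact Set.indicator_of_notMem (fun hA => hN σ hA (by simpa using hσ)) _
  refine (Finset.sum_le_card_nsmul _ _ _ hfib).trans_eq ?_
  simp [Fintype.card_piFinset]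

lemma le_cwMass {q n : ℕ} [NeZero q] (hn : 0 < n) (β h : ℝ) {A : Set (Fin n → Fin q)}
    (σ : Fin n → Fin q) (hA : ∀ τ, colorCount τ = colorCount σ → τ ∈ A) :
    Real.exp (-(n * freeEnergy q β h (empirical σ)) - β / 2 - q * (1 + Real.log (n + 1))) ≤
      cwMass q n β h A := by
  have hcard : 0 < (typeClass n (colorCount σ)).card :=
    Finset.card_pos.mpr ⟨σ, by simp [typeClass]⟩
  have hlog := le_log_typeClass_card hn σ
  calc _ ≤ ∑ τ ∈ typeClass n (colorCount σ), cwWeight q n β h τ := by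
        rw [sum_typeClass_cwWeight hn,
          ← Real.exp_log (show (0 : ℝ) < (typeClass n (colorCount σ)).card by positivity),
          ← Real.exp_add, ← Real.exp_add]
        gcongr
        linarith
    _ = ∑ τ ∈ typeClass n (colorCount σ), Set.indicator A (cwWeight q n β h) τ :=
        Finset.sum_congr rfl fun τ hτ =>
          (Set.indicator_of_mem (hA τ (by simpa [typeClass] using hτ)) _).symm
    _ ≤ _ := Finset.sum_le_sum_of_subset_of_nonneg (Finset.subset_univ _)
          fun τ _ _ => Set.indicator_nonneg (fun _ _ => (cwWeight_pos β h _).le) τ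

lemma exists_colorCount_eq {q n : ℕ} {N : Fin q → ℕ} (hN : ∑ k, N k = n) :
    ∃ σ : Fin n → Fin q, colorCount σ = N := by
  subst hN
  refine ⟨fun i => (finSigmaFinEquiv.symm i).1, funext fun k => ?_⟩
  have h1 : colorCount (fun i => (finSigmaFinEquiv (n := N).symm i).1) k =
      (univ.filter fun s : (i : Fin q) × Fin (N i) => s.1 = k).card :=
    Finset.card_equiv finSigmaFinEquiv.symm (by simp)
  rw [h1, ← Fintype.card_subtype]
  have h2 := Fintype.card_congr (Equiv.sigmaSubtype (β := fun i => Fin (N i)) k)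
  rw [Fintype.card_fin] at h2
  exact h2

lemma exists_empirical_near {q : ℕ} [NeZero q] {x : Fin q → ℝ} (hx : x ∈ simplex q) (n : ℕ) :
    ∃ σ : Fin n → Fin q, 0 < n → ∀ k, |empirical σ k - x k| ≤ (q + 1) / n := by
  rcases Nat.eq_zero_or_pos n with rfl | hn
  · exact ⟨fun _ => 0, fun h => absurd h (lt_irrefl _)⟩
  have hn' : (0 : ℝ) < n := by exact_mod_cast hn
  set a : Fin q → ℕ := fun k => ⌊n * x k⌋₊ with ha
  have hnx : ∑ k, (n : ℝ) * x k = n := by rw [← Finset.mul_sum, hx.2, mul_one]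
  have hle : ∀ k, (a k : ℝ) ≤ n * x k := fun k =>
    Nat.floor_le (mul_nonneg hn'.le (hx.1 k))
  have hlt : ∀ k, (n : ℝ) * x k ≤ a k + 1 := fun k => (Nat.lt_floor_add_one _).le
  have hsum_le : ∑ k, a k ≤ n := by
    have : ∑ k, (a k : ℝ) ≤ n := (Finset.sum_le_sum fun k _ => hle k).trans_eq hnx
    exact_mod_cast this
  have hrem : (n : ℝ) - ∑ k, (a k : ℝ) ≤ q := by
    have := Finset.sum_le_sum fun k (_ : k ∈ univ) => hlt k
    rw [hnx, Finset.sum_add_distrib] at this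
    simp at this
    linarith
  obtain ⟨σ, hσ⟩ := exists_colorCount_eq (n := n)
    (N := fun k => a k + if k = 0 then n - ∑ j, a j else 0)
    (by rw [Finset.sum_add_distrib]; simp; omega)
  refine ⟨σ, fun _ k => ?_⟩
  have hdiff : empirical σ k - x k = (colorCount σ k - n * x k) / n := by
    rw [← mul_empirical]
    field_simp
  rw [hdiff, abs_div, abs_of_pos hn']
  gcongr
  have hr : ((n - ∑ j, a j : ℕ) : ℝ) = n - ∑ j, (a j : ℝ) := by
    push_cast [Nat.cast_sub hsum_le]
    rfl
  have hr0 : (0 : ℝ) ≤ ((n - ∑ j, a j : ℕ) : ℝ) := Nat.cast_nonneg _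
  rw [hσ]
  push_cast
  have := hle k
  have := hlt k
  have hq : (0 : ℝ) ≤ q := Nat.cast_nonneg _
  split_ifs <;> rw [abs_le] <;> constructor <;> linarith

lemma continuous_freeEnergy (q : ℕ) [NeZero q] :
    Continuous fun p : ℝ × ℝ × (Fin q → ℝ) => freeEnergy q p.1 p.2.1 p.2.2 := by
  have hlog : ∀ i : Fin q, Continuous fun p : ℝ × ℝ × (Fin q → ℝ) =>
      p.2.2 i * Real.log (p.2.2 i) := fun i =>
    Real.continuous_mul_log.comp (by fun_prop : Continuous fun p : ℝ × ℝ × (Fin q → ℝ) => p.2.2 i)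
  have := continuous_finsetSum univ fun i _ => hlog i
  unfold freeEnergy
  fun_prop

lemma exists_isMinOn_freeEnergy (q : ℕ) [NeZero q] (β h : ℝ) :
    ∃ x ∈ simplex q, IsMinOn (freeEnergy q β h) (simplex q) x := by
  have hcpt : IsCompact (simplex q) := isCompact_stdSimplex ℝ (Fin q)
  have hcont : Continuous (freeEnergy q β h) :=
    (continuous_freeEnergy q).comp (by fun_prop : Continuous fun x : Fin q → ℝ => (β, h, x))
  exact hcpt.exists_isMinOn ⟨_, single_mem_stdSimplex ℝ (0 : Fin q)⟩ hcont.continuousOn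

lemma freeEnergy_le_add {q : ℕ} [NeZero q] (β h β' h' : ℝ) {x : Fin q → ℝ}
    (hx : x ∈ simplex q) :
    freeEnergy q β h x ≤ freeEnergy q β' h' x + (|β' - β| / 2 + |h' - h|) := by
  have hle1 : ∀ k, x k ≤ 1 := fun k =>
    (Finset.single_le_sum (fun i _ => hx.1 i) (Finset.mem_univ k)).trans_eq hx.2
  have hsq0 : 0 ≤ ∑ k, x k ^ 2 := Finset.sum_nonneg fun k _ => sq_nonneg _
  have hsq1 : ∑ k, x k ^ 2 ≤ 1 := by
    rw [← hx.2]
    exact Finset.sum_le_sum fun k _ => pow_le_of_le_one (hx.1 k) (hle1 k) two_ne_zero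
  have h1 : (β' - β) * ∑ k, x k ^ 2 ≤ |β' - β| :=
    (mul_le_mul_of_nonneg_right (le_abs_self _) hsq0).trans
      (mul_le_of_le_one_right (abs_nonneg _) hsq1)
  have h2 : (h' - h) * x 0 ≤ |h' - h| :=
    (mul_le_mul_of_nonneg_right (le_abs_self _) (hx.1 0)).trans
      (mul_le_of_le_one_right (abs_nonneg _) (hle1 0))
  unfold freeEnergy
  linarith

lemma tendsto_log_add_one_div : Tendsto (fun n : ℕ => Real.log ((n : ℝ) + 1) / n) atTop (𝓝 0) := by
  have h := (Real.tendsto_pow_log_div_mul_add_atTop 1 (-1) 1 one_ne_zero).comp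
    (tendsto_atTop_add_const_right _ 1 tendsto_natCast_atTop_atTop)
  refine h.congr fun n => ?_
  simp

lemma exists_cwMass_le {q : ℕ} [NeZero q] {β h : ℝ} {βseq hseq : ℕ → ℝ}
    (hβs : Tendsto βseq atTop (𝓝 β)) (hhs : Tendsto hseq atTop (𝓝 h))
    {F : Set (Fin q → ℝ)} {c : ℝ} (hF : F ⊆ simplex q) (hc : ∀ x ∈ F, c ≤ freeEnergy q β h x) :
    ∃ δ : ℕ → ℝ, Tendsto δ atTop (𝓝 0) ∧ ∀ n, 0 < n →
      cwMass q n (βseq n) (hseq n) {σ | empirical σ ∈ F} ≤ Real.exp (n * (-c + δ n)) := by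
  refine ⟨fun n => |βseq n - β| / 2 + |hseq n - h| + q * (Real.log (n + 1) / n)
    - βseq n / 2 / n, ?_, fun n hn => ?_⟩
  · have h1 := (hβs.sub_const β).abs.div_const 2
    have h2 := (hhs.sub_const h).abs
    have h3 := tendsto_log_add_one_div.const_mul (q : ℝ)
    have h4 := (hβs.div_const 2).div_atTop tendsto_natCast_atTop_atTop
    simpa using ((h1.add h2).add h3).sub h4
  · refine (cwMass_le hn (c := c - (|βseq n - β| / 2 + |hseq n - h|)) fun σ hσ => ?_).trans_eq ?_
    · have h1 := hc _ hσ
      have h2 := freeEnergy_le_add β h (βseq n) (hseq n) (hF hσ)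
      linarith
    · have hpow : ((n : ℝ) + 1) ^ q = Real.exp (q * Real.log (n + 1)) := by
        rw [mul_comm, Real.exp_mul, Real.exp_log (by positivity), Real.rpow_natCast]
      rw [hpow, ← Real.exp_add]
      congr 1
      field_simp
      ring

lemma exists_le_cwMass {q : ℕ} [NeZero q] {β h : ℝ} {βseq hseq : ℕ → ℝ}
    (hβs : Tendsto βseq atTop (𝓝 β)) (hhs : Tendsto hseq atTop (𝓝 h))
    {U : Set (Fin q → ℝ)} (hU : IsOpen U) {x : Fin q → ℝ} (hx : x ∈ simplex q) (hxU : x ∈ U) :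
    ∃ δ : ℕ → ℝ, Tendsto δ atTop (𝓝 0) ∧ ∀ᶠ n in atTop,
      Real.exp (n * (-freeEnergy q β h x + δ n)) ≤
        cwMass q n (βseq n) (hseq n) {σ | empirical σ ∈ U ∩ simplex q} := by
  choose σ hσ using exists_empirical_near hx
  have hlim : Tendsto (fun n => empirical (σ n)) atTop (𝓝 x) := by
    rw [tendsto_pi_nhds]
    intro k
    rw [tendsto_iff_norm_sub_tendsto_zero]
    exact squeeze_zero' (.of_forall fun _ => norm_nonneg _)
      ((eventually_gt_atTop 0).mono fun n hn => hσ n hn k)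
      (tendsto_const_nhds.div_atTop tendsto_natCast_atTop_atTop)
  have hf : Tendsto (fun n => freeEnergy q (βseq n) (hseq n) (empirical (σ n))) atTop
      (𝓝 (freeEnergy q β h x)) := by
    have hpair := hβs.prodMk_nhds (hhs.prodMk_nhds hlim)
    have hcont := (continuous_freeEnergy q).tendsto (β, h, x)
    simpa only [Function.comp_def] using hcont.comp hpair
  have hδ : Tendsto (fun n : ℕ => freeEnergy q β h x -
      freeEnergy q (βseq n) (hseq n) (empirical (σ n)) - βseq n / 2 / n -
        q * (1 / n + Real.log (n + 1) / n)) atTop (𝓝 0) := by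
    have h4 := (hβs.div_const 2).div_atTop tendsto_natCast_atTop_atTop
    have h3 := (tendsto_one_div_atTop_nhds_zero_nat.add tendsto_log_add_one_div).const_mul (q : ℝ)
    simpa using ((hf.const_sub (freeEnergy q β h x)).sub h4).sub h3
  refine ⟨_, hδ, ?_⟩
  filter_upwards [hlim.eventually_mem (hU.mem_nhds hxU), eventually_gt_atTop 0] with n hnU hn
  have hsub : ∀ τ, colorCount τ = colorCount (σ n) →
      τ ∈ {τ : Fin n → Fin q | empirical τ ∈ U ∩ simplex q} := by
    intro τ hτ
    have hemp : empirical τ = empirical (σ n) := by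
      unfold empirical
      rw [hτ]
    exact ⟨by rwa [hemp], empirical_mem_simplex hn τ⟩
  have hle := le_cwMass hn (βseq n) (hseq n) (σ n) hsub
  have hexp : (n : ℝ) * (-freeEnergy q β h x + (freeEnergy q β h x -
      freeEnergy q (βseq n) (hseq n) (empirical (σ n)) - βseq n / 2 / n -
        q * (1 / n + Real.log (n + 1) / n))) =
      -(n * freeEnergy q (βseq n) (hseq n) (empirical (σ n))) - βseq n / 2 -
        q * (1 + Real.log (n + 1)) := by
    field_simp
    ring
  rwa [hexp]

lemma cwProb_eq {q n : ℕ} [NeZero q] (hn : 0 < n) (β h : ℝ) (A : Set (Fin n → Fin q)) :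
    cwProb q n β h A = cwMass q n β h A / cwMass q n β h {σ | empirical σ ∈ simplex q} := by
  have : {σ : Fin n → Fin q | empirical σ ∈ simplex q} = Set.univ :=
    Set.eq_univ_of_forall fun σ => empirical_mem_simplex hn σ
  rw [this, cwProb, cwMass, cwMass, Set.indicator_univ, cwZ]

lemma inv_mul_log_ofReal_exp {n : ℕ} (hn : 0 < n) (a : ℝ) :
    (((n : ℝ)⁻¹ : ℝ) : EReal) * ENNReal.log (ENNReal.ofReal (Real.exp (n * a))) = (a : EReal) := by
  rw [ENNReal.log_ofReal_of_pos (Real.exp_pos _), Real.log_exp, ← EReal.coe_mul]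
  congr 1
  field_simp

lemma inv_mul_log_ofReal_mono (n : ℕ) {a b : ℝ} (hab : a ≤ b) :
    (((n : ℝ)⁻¹ : ℝ) : EReal) * ENNReal.log (ENNReal.ofReal a) ≤
      (((n : ℝ)⁻¹ : ℝ) : EReal) * ENNReal.log (ENNReal.ofReal b) :=
  mul_le_mul_of_nonneg_left (ENNReal.log_monotone (ENNReal.ofReal_le_ofReal hab))
    (EReal.coe_nonneg.mpr (by positivity))

lemma tendsto_coe_add_zero {δ : ℕ → ℝ} (hδ : Tendsto δ atTop (𝓝 0)) (c : ℝ) :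
    Tendsto (fun n => ((c + δ n : ℝ) : EReal)) atTop (𝓝 (c : EReal)) := by
  have := hδ.const_add c
  rw [add_zero] at this
  exact (continuous_coe_real_ereal.tendsto _).comp this

/-- large deviation principle for the empirical vector `N/n` under
`μ_{β_n,h_n,n}` with speed `n` and good rate function `I = f_{β,h} − min_Ω f_{β,h}`:
upper bound for closed sets `F ⊆ Ω`, lower bound for relatively open sets `G ⊆ Ω`. -/
theorem stmt_0 (q : ℕ) [NeZero q] (hq : 2 ≤ q) (β h : ℝ) (hβ : 0 ≤ β) (hh : 0 ≤ h)
    (βseq hseq : ℕ → ℝ)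
    (hβs : Tendsto βseq atTop (𝓝 β)) (hhs : Tendsto hseq atTop (𝓝 h)) :
    (∀ F : Set (Fin q → ℝ), F ⊆ simplex q → IsClosed F →
      Filter.limsup (fun n : ℕ =>
          ((((n : ℝ))⁻¹ : ℝ) : EReal) * ENNReal.log (ENNReal.ofReal
            (cwProb q n (βseq n) (hseq n)
              {σ | (fun k => (colorCount σ k : ℝ) / n) ∈ F}))) atTop
        ≤ - ⨅ x ∈ F, ((rateI q β h x : ℝ) : EReal)) ∧
    (∀ G : Set (Fin q → ℝ), G ⊆ simplex q →
      (∃ U : Set (Fin q → ℝ), IsOpen U ∧ G = U ∩ simplex q) →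
      - ⨅ x ∈ G, ((rateI q β h x : ℝ) : EReal)
        ≤ Filter.liminf (fun n : ℕ =>
            ((((n : ℝ))⁻¹ : ℝ) : EReal) * ENNReal.log (ENNReal.ofReal
              (cwProb q n (βseq n) (hseq n)
                {σ | (fun k => (colorCount σ k : ℝ) / n) ∈ G}))) atTop) := by
  obtain ⟨y, hy, hmin⟩ := exists_isMinOn_freeEnergy q β h
  have hrate : ∀ x, rateI q β h x = freeEnergy q β h x - freeEnergy q β h y := by
    intro x
    have hleast : IsLeast (freeEnergy q β h '' simplex q) (freeEnergy q β h y) :=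
      ⟨Set.mem_image_of_mem _ hy, by rintro _ ⟨z, hz, rfl⟩; exact hmin hz⟩
    rw [rateI, hleast.csInf_eq]
  refine ⟨fun F hF _ => ?_, fun G hG ⟨U, hU, hGU⟩ => ?_⟩
  · obtain ⟨δ, hδ, hZ⟩ := exists_le_cwMass hβs hhs isOpen_univ hy (Set.mem_univ _)
    rw [Set.univ_inter] at hZ
    refine EReal.le_of_forall_lt_iff_le.mp fun z hz => ?_
    have hzF : ∀ x ∈ F, freeEnergy q β h y - z ≤ freeEnergy q β h x := by
      intro x hx
      have h1 := (EReal.neg_lt_comm.mp hz).le.trans (iInf₂_le x hx)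
      rw [← EReal.coe_neg, EReal.coe_le_coe_iff, hrate] at h1
      linarith
    obtain ⟨δ', hδ', hM⟩ := exists_cwMass_le hβs hhs hF hzF
    have hdiff : Tendsto (fun n => δ' n - δ n) atTop (𝓝 0) := by simpa using hδ'.sub hδ
    rw [← (tendsto_coe_add_zero hdiff z).limsup_eq]
    refine limsup_le_limsup ?_
    filter_upwards [hZ, eventually_gt_atTop 0] with n hZn hn
    rw [← inv_mul_log_ofReal_exp hn (z + (δ' n - δ n))]
    refine inv_mul_log_ofReal_mono n ?_
    rw [cwProb_eq hn, div_le_iff₀ ((Real.exp_pos _).trans_le hZn)]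
    refine (hM n hn).trans ?_
    refine le_trans (le_of_eq ?_) (mul_le_mul_of_nonneg_left hZn (Real.exp_pos _).le)
    rw [← Real.exp_add]
    ring_nf
  · obtain ⟨δ, hδ, hZ⟩ := exists_cwMass_le hβs hhs subset_rfl fun x hx => hmin hx
    rw [EReal.neg_le]
    refine le_iInf₂ fun x hx => ?_
    rw [EReal.neg_le, ← EReal.coe_neg]
    have hxG := hx
    rw [hGU] at hxG
    obtain ⟨δ', hδ', hM⟩ := exists_le_cwMass hβs hhs hU hxG.2 hxG.1
    rw [← hGU] at hM
    have hdiff : Tendsto (fun n => δ' n - δ n) atTop (𝓝 0) := by simpa using hδ'.sub hδ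
    rw [← (tendsto_coe_add_zero hdiff (-rateI q β h x)).liminf_eq]
    refine liminf_le_liminf ?_
    filter_upwards [hM, eventually_gt_atTop 0] with n hMn hn
    rw [← inv_mul_log_ofReal_exp hn (-rateI q β h x + (δ' n - δ n))]
    refine inv_mul_log_ofReal_mono n ?_
    have hZpos : 0 < cwMass q n (βseq n) (hseq n) {σ | empirical σ ∈ simplex q} :=
      (Real.exp_pos _).trans_le (hMn.trans (cwMass_mono _ _ fun _ hτ => hG hτ))
    rw [cwProb_eq hn, le_div_iff₀ hZpos]
    refine (mul_le_mul_of_nonneg_left (hZ n hn) (Real.exp_pos _).le).trans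
      (le_trans (le_of_eq ?_) hMn)
    rw [← Real.exp_add, hrate]
    ring_nf
end

section
/- Let β, h ≥ 0 and let x be a global minimizer of f_{β,h} on Ω. Then the coordinate min_i(x_i) is attained by at least q − 1 of the coordinates of x, i.e. #{i ∈ {1,…,q} : x_i = min_j x_j} ≥ q − 1. -/
open Real Filter Finset

/-- The one-coordinate contribution `t log t - (β/2) t²` to the free energy. -/
noncomputable def coordEnergy (β t : ℝ) : ℝ := t * Real.log t - β / 2 * t ^ 2

lemma continuous_coordEnergy (β : ℝ) : Continuous (coordEnergy β) := by
  unfold coordEnergy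
  exact Real.continuous_mul_log.sub (by fun_prop)

lemma deriv_coordEnergy (β : ℝ) {t : ℝ} (ht : t ≠ 0) :
    deriv (coordEnergy β) t = Real.log t + 1 - β * t := by
  have h := (Real.hasDerivAt_mul_log ht).sub ((hasDerivAt_pow 2 t).const_mul (β / 2))
  refine HasDerivAt.deriv (h.congr_deriv ?_)
  norm_num
  ring

lemma deriv2_coordEnergy (β : ℝ) {t : ℝ} (ht : t ≠ 0) :
    deriv^[2] (coordEnergy β) t = t⁻¹ - β := by
  have he : deriv (coordEnergy β) =ᶠ[nhds t] fun s => Real.log s + 1 - β * s := by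
    filter_upwards [isOpen_ne.mem_nhds ht] with s hs
    exact deriv_coordEnergy β hs
  have h := ((Real.hasDerivAt_log ht).add_const 1).sub ((hasDerivAt_id t).const_mul β)
  rw [Function.iterate_succ, Function.iterate_one, Function.comp_apply, he.deriv_eq]
  exact HasDerivAt.deriv (h.congr_deriv (by ring))

lemma strictConvexOn_coordEnergy {β b : ℝ} (hβ : 0 ≤ β) (hb : β * b ≤ 1) :
    StrictConvexOn ℝ (Set.Icc 0 b) (coordEnergy β) := by
  refine strictConvexOn_of_deriv2_pos (convex_Icc 0 b)
    (continuous_coordEnergy β).continuousOn fun t ht => ?_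
  rw [interior_Icc] at ht
  have ht0 : 0 < t := ht.1
  rw [deriv2_coordEnergy β ht0.ne', sub_pos, ← one_div, lt_div_iff₀ ht0]
  rcases hβ.eq_or_lt with rfl | hβ0
  · simp
  · exact (mul_lt_mul_of_pos_left ht.2 hβ0).trans_le hb

lemma strictConcaveOn_coordEnergy {β a : ℝ} (ha : 0 < a) (hβ : 1 ≤ β * a) :
    StrictConcaveOn ℝ (Set.Ici a) (coordEnergy β) := by
  refine strictConcaveOn_of_deriv2_neg (convex_Ici a)
    (continuous_coordEnergy β).continuousOn fun t ht => ?_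
  rw [interior_Ici] at ht
  have hat : a < t := ht
  have ht0 : 0 < t := ha.trans hat
  rw [deriv2_coordEnergy β ht0.ne', sub_neg, inv_lt_iff_one_lt_mul₀ ht0]
  have hβ0 : 0 < β := by
    by_contra hn
    nlinarith
  nlinarith

lemma sum_update_update {ι : Type*} [Fintype ι] [DecidableEq ι] (F : ℝ → ℝ) (x : ι → ℝ)
    {i j : ι} (hij : i ≠ j) (u v : ℝ) :
    ∑ k, F (Function.update (Function.update x i u) j v k) =
      ∑ k, F (x k) + (F u - F (x i)) + (F v - F (x j)) := by
  have h (k : ι) : F (Function.update (Function.update x i u) j v k) =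
      F (x k) + (if k = i then F u - F (x i) else 0) + (if k = j then F v - F (x j) else 0) := by
    by_cases hj : k = j
    · subst hj
      simp [hij.symm]
    · by_cases hi : k = i
      · subst hi
        simp [hij]
      · simp [hi, hj]
  simp_rw [h, Finset.sum_add_distrib, Finset.sum_ite_eq' Finset.univ, Finset.mem_univ, if_true]

lemma freeEnergy_eq_sum_coordEnergy (q : ℕ) [NeZero q] (β h : ℝ) (x : Fin q → ℝ) :
    freeEnergy q β h x = ∑ i, coordEnergy β (x i) - h * x 0 := by
  simp [freeEnergy, coordEnergy, Finset.sum_sub_distrib, Finset.mul_sum]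

/-- A minimizer of the free energy also minimizes every redistribution of the mass of two
coordinates. -/
lemma coordEnergy_pair_le {q : ℕ} [NeZero q] {β h : ℝ} {x : Fin q → ℝ} (hx : x ∈ simplex q)
    (hmin : ∀ y ∈ simplex q, freeEnergy q β h x ≤ freeEnergy q β h y)
    {i j : Fin q} (hij : i ≠ j) {u v : ℝ} (hu : 0 ≤ u) (hv : 0 ≤ v) (huv : u + v = x i + x j) :
    coordEnergy β (x i) + coordEnergy β (x j) - h * x 0 ≤
      coordEnergy β u + coordEnergy β v -
        h * Function.update (Function.update x i u) j v 0 := by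
  have hy : Function.update (Function.update x i u) j v ∈ simplex q := by
    refine ⟨fun k => ?_, ?_⟩
    · by_cases hj : k = j
      · simpa [hj] using hv
      · by_cases hi : k = i
        · subst hi
          simpa [hj] using hu
        · simpa [hi, hj] using hx.1 k
    · have hs := sum_update_update id x hij u v
      simp only [id] at hs
      rw [hs, hx.2]
      linarith
  have hle := hmin _ hy
  rw [freeEnergy_eq_sum_coordEnergy, freeEnergy_eq_sum_coordEnergy,
    sum_update_update (coordEnergy β) x hij] at hle
  linarith

/-- A positive external field favours the coordinate it acts on. -/
lemma le_field_coord {q : ℕ} [NeZero q] {β h : ℝ} (hh : 0 < h) {x : Fin q → ℝ}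
    (hx : x ∈ simplex q)
    (hmin : ∀ y ∈ simplex q, freeEnergy q β h x ≤ freeEnergy q β h y) (i : Fin q) :
    x i ≤ x 0 := by
  by_cases hi : i = 0
  · rw [hi]
  have hle := coordEnergy_pair_le hx hmin (Ne.symm hi) (hx.1 i) (hx.1 0) (add_comm _ _)
  rw [Function.update_of_ne (Ne.symm hi), Function.update_self] at hle
  exact le_of_mul_le_mul_left (by linarith) hh

/-- Unequal coordinates not singled out by the field force the larger one into the range where
the coordinate energy is concave. -/
lemma one_lt_mul_of_lt {q : ℕ} [NeZero q] {β h : ℝ} (hβ : 0 ≤ β) {x : Fin q → ℝ}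
    (hx : x ∈ simplex q)
    (hmin : ∀ y ∈ simplex q, freeEnergy q β h x ≤ freeEnergy q β h y)
    {i j : Fin q} (hf : h = 0 ∨ (i ≠ 0 ∧ j ≠ 0)) (hlt : x i < x j) : 1 < β * x j := by
  by_contra! hb
  have hij : i ≠ j := fun e => hlt.ne (congrArg x e)
  have hi0 := hx.1 i
  have hm : 0 ≤ (x i + x j) / 2 := by linarith
  have hle := coordEnergy_pair_le hx hmin hij hm hm (by ring)
  have hfield : h * Function.update (Function.update x i ((x i + x j) / 2)) j
      ((x i + x j) / 2) 0 = h * x 0 := by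
    rcases hf with rfl | ⟨hi, hj⟩
    · simp
    · rw [Function.update_of_ne hj.symm, Function.update_of_ne hi.symm]
  have hconv := (strictConvexOn_coordEnergy hβ hb).2 ⟨hi0, hlt.le⟩ ⟨hi0.trans hlt.le, le_rfl⟩
    hlt.ne (show (0 : ℝ) < 1 / 2 by norm_num) (show (0 : ℝ) < 1 / 2 by norm_num) (by norm_num)
  simp only [smul_eq_mul] at hconv
  rw [show 1 / 2 * x i + 1 / 2 * x j = (x i + x j) / 2 by ring] at hconv
  linarith

/-- Two coordinates cannot both lie in the range where the coordinate energy is strictly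
concave. -/
lemma mul_le_one_of_le {q : ℕ} [NeZero q] {β h : ℝ} {x : Fin q → ℝ}
    (hx : x ∈ simplex q)
    (hmin : ∀ y ∈ simplex q, freeEnergy q β h x ≤ freeEnergy q β h y)
    {j m : Fin q} (hjm : m ≠ j) (hle : x j ≤ x m) : β * x j ≤ 1 := by
  by_contra! hb
  have hj0 : 0 < x j := (hx.1 j).lt_of_ne fun e => by
    rw [← e] at hb
    norm_num at hb
  have hβ : 0 < β := pos_of_mul_pos_left (one_pos.trans hb) hj0.le
  have ha : 0 < β⁻¹ := inv_pos.2 hβ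
  have haj : β⁻¹ < x j := (inv_lt_iff_one_lt_mul₀' hβ).2 hb
  have hconc := strictConcaveOn_coordEnergy ha (mul_inv_cancel₀ hβ.ne').ge
  set ε := x j - β⁻¹ with hε
  have hε0 : 0 < ε := sub_pos.2 haj
  have hmid (t : ℝ) (ht : x j ≤ t) :
      coordEnergy β (t + ε) + coordEnergy β (t - ε) < 2 * coordEnergy β t := by
    have hc := hconc.2 (show t + ε ∈ Set.Ici β⁻¹ from by simp only [Set.mem_Ici]; linarith)
      (show t - ε ∈ Set.Ici β⁻¹ from by simp only [Set.mem_Ici]; linarith) (by linarith)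
      (show (0 : ℝ) < 1 / 2 by norm_num) (show (0 : ℝ) < 1 / 2 by norm_num) (by norm_num)
    simp only [smul_eq_mul] at hc
    rw [show 1 / 2 * (t + ε) + 1 / 2 * (t - ε) = t by ring] at hc
    linarith
  have h1 := coordEnergy_pair_le hx hmin hjm (u := x m + ε) (v := x j - ε)
    (by linarith) (by linarith) (by ring)
  have h2 := coordEnergy_pair_le hx hmin hjm (u := x m - ε) (v := x j + ε)
    (by linarith) (by linarith) (by ring)
  have hfield : Function.update (Function.update x m (x m + ε)) j (x j - ε) 0 +
      Function.update (Function.update x m (x m - ε)) j (x j + ε) 0 = 2 * x 0 := by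
    by_cases hj : 0 = j
    · rw [hj]
      simp only [Function.update_self]
      ring
    · rw [Function.update_of_ne hj, Function.update_of_ne hj]
      by_cases hm : 0 = m
      · rw [hm]
        simp only [Function.update_self]
        ring
      · rw [Function.update_of_ne hm, Function.update_of_ne hm]
        ring
  have hfield' := congrArg (h * ·) hfield
  simp only [mul_add] at hfield'
  linarith [hmid _ le_rfl, hmid _ hle]

/-- any global minimizer of the free energy has its minimal
coordinate repeated at least `q − 1` times. -/
theorem stmt_1 (q : ℕ) [NeZero q] (hq : 2 ≤ q) (β h : ℝ) (hβ : 0 ≤ β) (hh : 0 ≤ h)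
    (x : Fin q → ℝ) (hx : x ∈ simplex q)
    (hmin : ∀ y ∈ simplex q, freeEnergy q β h x ≤ freeEnergy q β h y) :
    q - 1 ≤ (Finset.univ.filter (fun i => x i = ⨅ j, x j)).card := by
  have : Nonempty (Fin q) := ⟨0⟩
  obtain ⟨m, hm, hfield⟩ : ∃ m, (∀ i, x i ≤ x m) ∧ (h = 0 ∨ m = 0) := by
    rcases hh.eq_or_lt with h0 | h0
    · obtain ⟨m, hm⟩ := Finite.exists_max x
      exact ⟨m, hm, Or.inl h0.symm⟩
    · exact ⟨0, le_field_coord h0 hx hmin, Or.inr rfl⟩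
  have hnlt (i j : Fin q) (hi : i ≠ m) (hj : j ≠ m) : ¬ x i < x j := fun hlt =>
    (one_lt_mul_of_lt hβ hx hmin (hfield.imp_right fun e => ⟨e ▸ hi, e ▸ hj⟩) hlt).not_ge
      (mul_le_one_of_le hx hmin hj.symm (hm j))
  obtain ⟨k, hk⟩ := exists_eq_ciInf_of_finite (f := x)
  have hkle (i : Fin q) : x k ≤ x i := hk ▸ ciInf_le (Set.finite_range x).bddBelow i
  have hsub : Finset.univ.erase m ⊆ Finset.univ.filter (fun i => x i = ⨅ j, x j) := by
    intro i hi
    have him : i ≠ m := Finset.ne_of_mem_erase hi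
    rw [Finset.mem_filter, ← hk]
    refine ⟨Finset.mem_univ i, le_antisymm ?_ (hkle i)⟩
    by_cases hkm : k = m
    · exact hkm ▸ hm i
    · exact not_lt.1 (hnlt k i hkm him)
  simpa using Finset.card_le_card hsub
end

section
/- Let β ≥ 0 and h > 0, and let x be a global minimizer of f_{β,h} on Ω. Then x_1 > x_i for every i ∈ {2,…,q}. -/
open Real Filter Finset

/-- Changing two coordinates of a vector changes a sum over its coordinates in two terms. -/
theorem sum_comp_update_update {ι : Type*} [Fintype ι] [DecidableEq ι] (φ : ℝ → ℝ) (x : ι → ℝ)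
    {i j : ι} (hij : j ≠ i) (u v : ℝ) :
    ∑ k, φ (Function.update (Function.update x i u) j v k) =
      ∑ k, φ (x k) + (φ u - φ (x i)) + (φ v - φ (x j)) := by
  have hdiff : ∑ k, (φ (Function.update (Function.update x i u) j v k) - φ (x k)) =
      (φ u - φ (x i)) + (φ v - φ (x j)) := by
    rw [Fintype.sum_eq_add i j hij.symm]
    · simp [Function.update_of_ne hij.symm]
    · rintro k ⟨hki, hkj⟩
      simp [Function.update_of_ne hki, Function.update_of_ne hkj]
  rw [Finset.sum_sub_distrib] at hdiff
  linarith

/-- A minimizer of the free energy also minimizes the contribution of the coordinates `0` and `j`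
when the mass of these two coordinates is redistributed. -/
theorem pair_le_of_isMin {q : ℕ} [NeZero q] {β h : ℝ} {x : Fin q → ℝ} (hx : x ∈ simplex q)
    (hmin : ∀ y ∈ simplex q, freeEnergy q β h x ≤ freeEnergy q β h y) {j : Fin q} (hj : j ≠ 0)
    {u v : ℝ} (hu : 0 ≤ u) (hv : 0 ≤ v) (huv : u + v = x 0 + x j) :
    x 0 * Real.log (x 0) + x j * Real.log (x j) - β / 2 * (x 0 ^ 2 + x j ^ 2) - h * x 0 ≤
      u * Real.log u + v * Real.log v - β / 2 * (u ^ 2 + v ^ 2) - h * u := by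
  have hmem : Function.update (Function.update x 0 u) j v ∈ simplex q := by
    refine ⟨fun k => ?_, ?_⟩
    · simp only [Function.update_apply]
      split_ifs
      exacts [hv, hu, hx.1 k]
    · have hsum := sum_comp_update_update (fun s => s) x hj u v
      have := hx.2
      linarith
  have hle := hmin _ hmem
  unfold freeEnergy at hle
  rw [sum_comp_update_update (fun s => s * Real.log s) x hj u v,
    sum_comp_update_update (fun s => s ^ 2) x hj u v,
    Function.update_of_ne hj.symm, Function.update_self] at hle
  linarith

/-- if `h > 0`, any global minimizer `x` of the free energy has
`x_1 > x_i` for every `i ∈ {2,…,q}`. -/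
theorem stmt_2 (q : ℕ) [NeZero q] (hq : 2 ≤ q) (β h : ℝ) (hβ : 0 ≤ β) (hh : 0 < h)
    (x : Fin q → ℝ) (hx : x ∈ simplex q)
    (hmin : ∀ y ∈ simplex q, freeEnergy q β h x ≤ freeEnergy q β h y) :
    ∀ i : Fin q, i ≠ 0 → x i < x 0 := by
  have hx0 : 0 < x 0 := by
    obtain ⟨j, -, hj⟩ : ∃ j ∈ Finset.univ, 0 < x j := by
      refine Finset.exists_lt_of_sum_lt (f := fun _ => (0 : ℝ)) ?_
      simp [hx.2]
    by_contra hneg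
    have h0 : x 0 = 0 := le_antisymm (not_lt.mp hneg) (hx.1 0)
    have hj0 : j ≠ 0 := by
      rintro rfl
      exact hneg hj
    set b := x j with hb
    set t := b * Real.exp (-(β * b)) with ht
    have ht0 : 0 < t := by positivity
    have htb : t ≤ b := by
      have : Real.exp (-(β * b)) ≤ 1 := Real.exp_le_one_iff.mpr (by nlinarith)
      nlinarith
    have hlogt : Real.log t = Real.log b - β * b := by
      rw [ht, Real.log_mul hj.ne' (Real.exp_pos _).ne', Real.log_exp]
      ring
    have key := pair_le_of_isMin hx hmin hj0 ht0.le (sub_nonneg.mpr htb) (by rw [h0, ← hb]; ring)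
    rw [h0, ← hb, hlogt] at key
    have hmono : (b - t) * Real.log (b - t) ≤ (b - t) * Real.log b := by
      rcases htb.eq_or_lt with heq | hlt
      · simp [heq]
      · exact mul_le_mul_of_nonneg_left
          (Real.log_le_log (sub_pos.mpr hlt) (by linarith)) (sub_nonneg.mpr htb)
    have h1 : 0 ≤ β * t ^ 2 := by positivity
    have h2 : 0 < h * t := by positivity
    nlinarith
  intro i hi
  rcases lt_trichotomy (x i) (x 0) with hlt | heq | hgt
  · exact hlt
  · exfalso
    set a := x 0 with ha
    let g : ℝ → ℝ := fun t => (a + t) * Real.log (a + t) + (a - t) * Real.log (a - t)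
      - β / 2 * ((a + t) ^ 2 + (a - t) ^ 2) - h * (a + t)
    have hloc : IsLocalMin g 0 := by
      filter_upwards [Ioo_mem_nhds (neg_lt_zero.mpr hx0) hx0] with t ht
      have key := pair_le_of_isMin hx hmin hi (u := a + t) (v := a - t)
        (by linarith [ht.1]) (by linarith [ht.2]) (by rw [heq, ← ha]; ring)
      rw [heq, ← ha] at key
      simpa [g] using key
    have hp : HasDerivAt (fun t : ℝ => a + t) 1 0 := (hasDerivAt_id (0 : ℝ)).const_add a
    have hm : HasDerivAt (fun t : ℝ => a - t) (-1) 0 := (hasDerivAt_id (0 : ℝ)).const_sub a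
    have hd := (((hp.mul (hp.log (by simpa using hx0.ne'))).add
      (hm.mul (hm.log (by simpa using hx0.ne')))).sub
      (((hp.pow 2).add (hm.pow 2)).const_mul (β / 2))).sub (hp.const_mul h)
    have hzero := hloc.hasDerivAt_eq_zero hd
    simp only [add_zero, sub_zero] at hzero
    field_simp at hzero
    norm_num at hzero
    linarith
  · have key := pair_le_of_isMin hx hmin hi (hx.1 i) (hx.1 0) (add_comm _ _)
    nlinarith
end

section
/- Let β, h ≥ 0 and let x be a global minimizer of f_{β,h} on Ω. If q ≥ 3, or if q = 2 and (β,h) ≠ (β_c, 0), then β · min_{1≤i≤q}(x_i) < 1 (i.e. min_i x_i < 1/β whenever β > 0). -/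
open Real Filter Finset

/-- The critical inverse temperature `β_c`. -/
noncomputable def betaC (q : ℕ) : ℝ :=
  if q ≤ 2 then (q : ℝ) else 2 * ((q : ℝ) - 1) / ((q : ℝ) - 2) * Real.log ((q : ℝ) - 1)

theorem mul_log_add_le {a s : ℝ} (ha : 0 < a) (hs : |s| ≤ a / 2) :
    (a + s) * Real.log (a + s) ≤ a * Real.log a + s * (Real.log a + 1) + s ^ 2 * (1 / (2 * a))
      - s ^ 3 * (1 / (6 * a ^ 2)) + s ^ 4 * (4 / a ^ 3) := by
  obtain ⟨u, rfl⟩ : ∃ u, s = a * u := ⟨s / a, by field_simp⟩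
  have hu : |u| ≤ 1 / 2 := by
    rw [abs_mul, abs_of_pos ha] at hs
    nlinarith
  obtain ⟨hu1, hu2⟩ := abs_le.1 hu
  have hlog : Real.log (1 + u) ≤ u - u ^ 2 / 2 + u ^ 3 / 3 + 2 * u ^ 4 := by
    have key := Real.abs_log_sub_add_sum_range_le (x := -u) (by rw [abs_neg]; linarith) 3
    have hb : |(-u)| ^ (3 + 1) / (1 - |(-u)|) ≤ 2 * u ^ 4 := by
      have h4 : |u| ^ 4 = u ^ 4 := by
        rw [show (4 : ℕ) = 2 * 2 by norm_num, pow_mul, sq_abs, ← pow_mul]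
      rw [abs_neg, show 3 + 1 = 4 by norm_num, h4, div_le_iff₀ (by linarith)]
      have : 0 ≤ u ^ 4 := by positivity
      nlinarith
    have h1 := (abs_le.1 (key.trans hb)).2
    norm_num [Finset.sum_range_succ] at h1
    nlinarith
  have hsplit : Real.log (a + a * u) = Real.log a + Real.log (1 + u) := by
    rw [← Real.log_mul ha.ne' (by linarith)]
    ring_nf
  have hmul := mul_le_mul_of_nonneg_left hlog
    (mul_nonneg ha.le (by linarith : (0 : ℝ) ≤ 1 + u))
  have hrem : a * (1 / 3 + 2 + 2 * u) * u ^ 4 ≤ a * 4 * u ^ 4 := by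
    gcongr
    linarith
  have hrhs : a * Real.log a + a * u * (Real.log a + 1) + (a * u) ^ 2 * (1 / (2 * a))
      - (a * u) ^ 3 * (1 / (6 * a ^ 2)) + (a * u) ^ 4 * (4 / a ^ 3)
      = a * Real.log a + a * u * (Real.log a + 1) + a * u ^ 2 / 2 - a * u ^ 3 / 6
        + a * 4 * u ^ 4 := by
    field_simp
  rw [hsplit, hrhs]
  linarith

theorem nonneg_of_eventually_nonneg {g : ℝ → ℝ} (hg : Continuous g)
    (h : ∀ᶠ t in nhdsWithin (0 : ℝ) (Set.Ioi 0), 0 ≤ g t) : 0 ≤ g 0 :=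
  ge_of_tendsto (hg.continuousAt.tendsto.mono_left nhdsWithin_le_nhds) h

theorem eq_zero_of_eventually_mul_nonneg {g : ℝ → ℝ} (hg : Continuous g)
    (h : ∀ᶠ t in nhds (0 : ℝ), 0 ≤ t * g t) : g 0 = 0 := by
  apply le_antisymm
  · refine le_of_tendsto (hg.continuousAt.tendsto.mono_left
      (nhdsWithin_le_nhds (s := Set.Iio 0))) ?_
    filter_upwards [h.filter_mono nhdsWithin_le_nhds, self_mem_nhdsWithin] with t ht ht0
    exact nonpos_of_mul_nonneg_right ht ht0
  · refine nonneg_of_eventually_nonneg hg ?_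
    filter_upwards [h.filter_mono nhdsWithin_le_nhds, self_mem_nhdsWithin] with t ht ht0
    exact nonneg_of_mul_nonneg_right ht ht0

theorem quartic_coeffs_of_eventually_nonneg {a b c d : ℝ}
    (h : ∀ᶠ t in nhds (0 : ℝ), 0 ≤ a * t + b * t ^ 2 + c * t ^ 3 + d * t ^ 4) :
    a = 0 ∧ 0 ≤ b ∧ (b = 0 → c = 0) := by
  have ha : a = 0 := by
    have := eq_zero_of_eventually_mul_nonneg
      (g := fun t => a + b * t + c * t ^ 2 + d * t ^ 3) (by fun_prop)
      (h.mono fun t ht => ht.trans_eq (by ring))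
    simpa using this
  subst ha
  refine ⟨rfl, ?_, ?_⟩
  · have := nonneg_of_eventually_nonneg (g := fun t => b + c * t + d * t ^ 2) (by fun_prop) (by
      filter_upwards [h.filter_mono nhdsWithin_le_nhds, self_mem_nhdsWithin] with t ht ht0
      have ht2 : 0 < t ^ 2 := pow_pos ht0 2
      exact nonneg_of_mul_nonneg_right (ht.trans_eq (by ring)) ht2)
    simpa using this
  · rintro rfl
    have := eq_zero_of_eventually_mul_nonneg (g := fun t => c + d * t) (by fun_prop) (by
      filter_upwards [h] with t ht
      by_cases ht0 : t = 0
      · simp [ht0]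
      have ht2 : 0 < t ^ 2 := by positivity
      exact nonneg_of_mul_nonneg_right (ht.trans_eq (by ring)) ht2)
    simpa using this

/-- First, second and third order necessary conditions at an interior minimizer. -/
theorem freeEnergy_minimizer_conditions {q : ℕ} [NeZero q] {β h : ℝ} {x : Fin q → ℝ}
    (hx : x ∈ simplex q) (hpos : ∀ i, 0 < x i)
    (hmin : ∀ y ∈ simplex q, freeEnergy q β h x ≤ freeEnergy q β h y)
    (v : Fin q → ℝ) (hv : ∑ i, v i = 0) :
    (∑ i, v i * (Real.log (x i) + 1 - β * x i) - h * v 0 = 0) ∧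
    (0 ≤ ∑ i, v i ^ 2 * (1 / (2 * x i) - β / 2)) ∧
    (∑ i, v i ^ 2 * (1 / (2 * x i) - β / 2) = 0 →
      ∑ i, v i ^ 3 * (1 / (6 * x i ^ 2)) = 0) := by
  have hev : ∀ᶠ t in nhds (0 : ℝ), ∀ i, |t * v i| ≤ x i / 2 := by
    refine eventually_all.2 fun i => ?_
    have hc : ContinuousAt (fun t : ℝ => |t * v i|) 0 := by fun_prop
    have hlt : |0 * v i| < x i / 2 := by simpa using hpos i
    exact (hc.eventually_lt continuousAt_const hlt).mono fun t ht => ht.le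
  have hpoly : ∀ᶠ t in nhds (0 : ℝ),
      0 ≤ (∑ i, v i * (Real.log (x i) + 1 - β * x i) - h * v 0) * t
        + (∑ i, v i ^ 2 * (1 / (2 * x i) - β / 2)) * t ^ 2
        + (-∑ i, v i ^ 3 * (1 / (6 * x i ^ 2))) * t ^ 3
        + (∑ i, v i ^ 4 * (4 / x i ^ 3)) * t ^ 4 := by
    filter_upwards [hev] with t ht
    have hy : (fun i => x i + t * v i) ∈ simplex q := by
      refine ⟨fun i => ?_, ?_⟩
      · have := (abs_le.1 (ht i)).1
        linarith [hpos i]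
      · rw [Finset.sum_add_distrib, ← Finset.mul_sum, hv, hx.2]
        ring
    have hle := hmin _ hy
    have hsum := Finset.sum_le_sum fun i (_ : i ∈ Finset.univ) => mul_log_add_le (hpos i) (ht i)
    have hid : ∑ i, (x i * Real.log (x i) + t * v i * (Real.log (x i) + 1)
          + (t * v i) ^ 2 * (1 / (2 * x i)) - (t * v i) ^ 3 * (1 / (6 * x i ^ 2))
          + (t * v i) ^ 4 * (4 / x i ^ 3))
        - β / 2 * ∑ i, (x i + t * v i) ^ 2 - (∑ i, x i * Real.log (x i) - β / 2 * ∑ i, x i ^ 2)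
        = (∑ i, v i * (Real.log (x i) + 1 - β * x i)) * t
          + (∑ i, v i ^ 2 * (1 / (2 * x i) - β / 2)) * t ^ 2
          + (-∑ i, v i ^ 3 * (1 / (6 * x i ^ 2))) * t ^ 3
          + (∑ i, v i ^ 4 * (4 / x i ^ 3)) * t ^ 4 := by
      simp only [← Finset.sum_neg_distrib, Finset.mul_sum, Finset.sum_mul,
        ← Finset.sum_sub_distrib, ← Finset.sum_add_distrib]
      exact Finset.sum_congr rfl fun i _ => by ring
    simp only [freeEnergy] at hle
    linarith
  obtain ⟨h1, h2, h3⟩ := quartic_coeffs_of_eventually_nonneg hpoly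
  exact ⟨h1, h2, fun h0 => neg_eq_zero.1 (h3 h0)⟩

/-- for a global minimizer `x` of the free energy,
if `q ≥ 3`, or `q = 2` and `(β,h) ≠ (β_c,0)`, then `β · min_i x_i < 1`. -/
theorem stmt_4 (q : ℕ) [NeZero q] (hq : 2 ≤ q) (β h : ℝ) (hβ : 0 ≤ β) (hh : 0 ≤ h)
    (x : Fin q → ℝ) (hx : x ∈ simplex q)
    (hmin : ∀ y ∈ simplex q, freeEnergy q β h x ≤ freeEnergy q β h y)
    (hcase : 3 ≤ q ∨ (q = 2 ∧ (β, h) ≠ (betaC q, 0))) :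
    β * (⨅ i, x i) < 1 := by
  by_contra! hcon
  have hge : ∀ i, 1 ≤ β * x i := fun i =>
    hcon.trans (mul_le_mul_of_nonneg_left (ciInf_le (Set.finite_range x).bddBelow i) hβ)
  have hpos : ∀ i, 0 < x i := fun i =>
    pos_of_mul_pos_right (lt_of_lt_of_le one_pos (hge i)) hβ
  have hcond := freeEnergy_minimizer_conditions hx hpos hmin
  have hcoef : ∀ i, 1 / (2 * x i) - β / 2 ≤ 0 := fun i => by
    have := hpos i
    rw [sub_nonpos, div_le_div_iff₀ (by positivity) two_pos]
    nlinarith [hge i]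
  have hzero : ∀ i, 1 / (2 * x i) - β / 2 = 0 := by
    intro i
    have : Nontrivial (Fin q) := Fin.nontrivial_iff_two_le.2 hq
    obtain ⟨j, hj⟩ := exists_ne i
    obtain ⟨-, h2, -⟩ := hcond (Pi.single i 1 - Pi.single j 1) (by simp)
    have hterm : ∀ k ∈ Finset.univ, (Pi.single i 1 - Pi.single j 1 : Fin q → ℝ) k ^ 2
        * (1 / (2 * x k) - β / 2) ≤ 0 := fun k _ =>
      mul_nonpos_of_nonneg_of_nonpos (sq_nonneg _) (hcoef k)
    have h0 := (Finset.sum_eq_zero_iff_of_nonpos hterm).1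
      (le_antisymm (Finset.sum_nonpos hterm) h2) i (Finset.mem_univ i)
    simpa [Pi.single_eq_of_ne hj.symm] using h0
  have hxβ : ∀ i, β * x i = 1 := fun i => by
    have := hpos i
    have h0 := hzero i
    field_simp at h0
    linarith
  have hβ0 : β ≠ 0 := fun h0 => by simpa [h0] using hxβ 0
  have hxe : ∀ i, x i = 1 / β := fun i => by
    rw [eq_div_iff hβ0, mul_comm]
    exact hxβ i
  rcases hcase with h3 | ⟨rfl, hne⟩
  · obtain ⟨n, rfl⟩ : ∃ n, q = n + 3 := ⟨q - 3, by omega⟩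
    obtain ⟨-, -, hc⟩ := hcond (Fin.cons 2 (Fin.cons (-1) (Fin.cons (-1) 0)))
      (by simp [Fin.sum_univ_succ]; norm_num)
    have h0 := hc (Finset.sum_eq_zero fun i _ => by rw [hzero i, mul_zero])
    simp only [hxe, ← Finset.sum_mul] at h0
    rw [mul_eq_zero] at h0
    rcases h0 with h0 | h0
    · norm_num [Fin.sum_univ_succ] at h0
    · simp [hβ0] at h0
  · apply hne
    obtain ⟨h1, -, -⟩ := hcond ![1, -1] (by simp)
    have hsum := hx.2
    simp only [hxe, Fin.sum_univ_two] at h1 hsum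
    have hβ2 : β = 2 := by
      field_simp at hsum
      linarith
    have hh0 : h = 0 := by
      simpa using h1
    simp [betaC, hβ2, hh0]
end

section
/- For every (β,h) with β ≥ 0, h > 0 and (β,h) ∉ h_T, the free energy f_{β,h} has a unique global minimizer in Ω. Moreover, the map sending (β,h) to this unique global minimizer is real-analytic (coordinatewise) on the set {(β,h) : β ≥ 0, h > 0} ∖ (h_T ∪ {(β_0,h_0)}). -/
open Real Filter Finset Topology

/-- `β_0 = 4(q−1)/q`. -/
noncomputable def beta0 (q : ℕ) : ℝ := 4 * ((q : ℝ) - 1) / q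

/-- `h_0 = log(q−1) − 2(q−2)/q`. -/
noncomputable def h0 (q : ℕ) : ℝ := Real.log ((q : ℝ) - 1) - 2 * ((q : ℝ) - 2) / q

/-- The critical line `h_T = {(β,h) : 0 ≤ h < h_0, h = log(q−1) − β(q−2)/(2(q−1))}`. -/
noncomputable def criticalLine (q : ℕ) : Set (ℝ × ℝ) :=
  {p | 0 ≤ p.2 ∧ p.2 < h0 q ∧
    p.2 = Real.log ((q : ℝ) - 1) - p.1 * ((q : ℝ) - 2) / (2 * ((q : ℝ) - 1))}

open scoped ContDiff

/-- The log-odds function `s ↦ log (s / (1 - s))`. -/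
noncomputable def logOdds (s : ℝ) : ℝ := Real.log s - Real.log (1 - s)

lemma logOdds_one_sub (s : ℝ) : logOdds (1 - s) = -logOdds s := by
  simp [logOdds]

lemma logOdds_half : logOdds (1 / 2) = 0 := by
  norm_num [logOdds]

lemma hasDerivAt_logOdds {s : ℝ} (h0 : 0 < s) (h1 : s < 1) :
    HasDerivAt logOdds (s⁻¹ + (1 - s)⁻¹) s := by
  have h := (Real.hasDerivAt_log h0.ne').sub
    (((hasDerivAt_id s).const_sub 1).log (sub_pos.2 h1).ne')
  refine h.congr_deriv ?_
  simp [neg_div]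

lemma strictConvexOn_logOdds : StrictConvexOn ℝ (Set.Ico (1 / 2) 1) logOdds := by
  refine StrictMonoOn.strictConvexOn_of_deriv (convex_Ico _ _) ?_ ?_
  · intro x hx
    exact (hasDerivAt_logOdds (by linarith [hx.1]) hx.2).continuousAt.continuousWithinAt
  · rw [interior_Ico]
    intro x hx y hy hxy
    have hx1 := hx.1
    have hy1 := hy.2
    rw [(hasDerivAt_logOdds (by linarith) hx.2).deriv,
      (hasDerivAt_logOdds (by linarith) hy.2).deriv]
    have e : ∀ z : ℝ, 1 / 2 < z → z < 1 → z⁻¹ + (1 - z)⁻¹ = (z * (1 - z))⁻¹ := by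
      intro z h1 h2
      have : z ≠ 0 := by linarith
      have : 1 - z ≠ 0 := by linarith
      field_simp
      ring
    rw [e x hx.1 hx.2, e y hy.1 hy.2]
    exact inv_strictAnti₀ (mul_pos (by linarith) (by linarith)) (by nlinarith)

lemma lt_logOdds {s : ℝ} (h0 : 1 / 2 < s) (h1 : s < 1) : 4 * (s - 1 / 2) < logOdds s := by
  have h := strictConvexOn_logOdds.lt_slope_of_hasDerivAt (by norm_num) ⟨h0.le, h1⟩ h0
    (hasDerivAt_logOdds (by norm_num) (by norm_num))
  rw [slope_def_field, logOdds_half, sub_zero, lt_div_iff₀ (by linarith)] at h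
  norm_num at h ⊢
  exact h

lemma logOdds_lt {s : ℝ} (h0 : 1 / 2 < s) (h1 : s < 1) :
    logOdds s < (s⁻¹ + (1 - s)⁻¹) * (s - 1 / 2) := by
  have h := strictConvexOn_logOdds.slope_lt_of_hasDerivAt (by norm_num) ⟨h0.le, h1⟩ h0
    (hasDerivAt_logOdds (by linarith) h1)
  rwa [slope_def_field, logOdds_half, sub_zero, div_lt_iff₀ (by linarith)] at h

/-- `s` is a critical point of the Curie–Weiss (Ising) free energy with coupling `b` and field `c`
lying on the side of `1 / 2` favoured by the field. -/
structure IsFavouredRoot (b c s : ℝ) : Prop where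
  pos : 0 < s
  lt_one : s < 1
  eq : logOdds s = b * (s - 1 / 2) - c
  side : c * (s - 1 / 2) ≤ 0

namespace IsFavouredRoot

variable {b c s t : ℝ}

lemma one_sub (hs : IsFavouredRoot b c s) : IsFavouredRoot b (-c) (1 - s) where
  pos := by linarith [hs.lt_one]
  lt_one := by linarith [hs.pos]
  eq := by rw [logOdds_one_sub, hs.eq]; ring
  side := by linarith [hs.side]

lemma ne_half (hs : IsFavouredRoot b c s) (hc : c ≠ 0) : s ≠ 1 / 2 := by
  rintro rfl
  have := hs.eq
  rw [logOdds_half] at this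
  apply hc
  linarith

lemma half_lt (hs : IsFavouredRoot b c s) (hc : c < 0) : 1 / 2 < s := by
  refine lt_of_le_of_ne ?_ (hs.ne_half hc.ne).symm
  nlinarith [hs.side]

lemma not_half_lt_of_le_four (hs : IsFavouredRoot b 0 s) (hb : b ≤ 4) : ¬ 1 / 2 < s := by
  intro h
  have := lt_logOdds h hs.lt_one
  rw [hs.eq] at this
  nlinarith

lemma eq_half (hs : IsFavouredRoot b 0 s) (hb : b ≤ 4) : s = 1 / 2 := by
  have h1 := hs.not_half_lt_of_le_four hb
  have h2 := (neg_zero (G := ℝ) ▸ hs.one_sub).not_half_lt_of_le_four hb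
  linarith

lemma not_lt_of_neg (hs : IsFavouredRoot b c s) (ht : IsFavouredRoot b c t) (hc : c < 0) :
    ¬ s < t := by
  intro hst
  have h := strictConvexOn_logOdds.slope_strict_mono_adjacent (by norm_num)
    ⟨(ht.half_lt hc).le, ht.lt_one⟩ (hs.half_lt hc) hst
  have hs' := hs.half_lt hc
  rw [hs.eq, ht.eq, logOdds_half, div_lt_div_iff₀ (by linarith) (by linarith)] at h
  nlinarith

lemma unique_of_neg (hs : IsFavouredRoot b c s) (ht : IsFavouredRoot b c t) (hc : c < 0) :
    s = t :=
  le_antisymm (not_lt.1 (ht.not_lt_of_neg hs hc)) (not_lt.1 (hs.not_lt_of_neg ht hc))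

lemma unique (hs : IsFavouredRoot b c s) (ht : IsFavouredRoot b c t) (hbc : c ≠ 0 ∨ b ≤ 4) :
    s = t := by
  rcases lt_trichotomy c 0 with hc | rfl | hc
  · exact hs.unique_of_neg ht hc
  · have hb : b ≤ 4 := by simpa using hbc
    rw [hs.eq_half hb, ht.eq_half hb]
  · have := hs.one_sub.unique_of_neg ht.one_sub (by linarith)
    linarith

lemma lt_deriv_of_neg (hs : IsFavouredRoot b c s) (hc : c < 0) : b < s⁻¹ + (1 - s)⁻¹ := by
  have h := logOdds_lt (hs.half_lt hc) hs.lt_one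
  have hs' := hs.half_lt hc
  rw [hs.eq] at h
  by_contra! hb
  nlinarith

lemma lt_deriv (hs : IsFavouredRoot b c s) (hbc : c ≠ 0 ∨ b < 4) : b < s⁻¹ + (1 - s)⁻¹ := by
  rcases lt_trichotomy c 0 with hc | rfl | hc
  · exact hs.lt_deriv_of_neg hc
  · have hb : b < 4 := by simpa using hbc
    rw [hs.eq_half hb.le]
    norm_num
    exact hb
  · have := hs.one_sub.lt_deriv_of_neg (by linarith)
    rw [sub_sub_cancel] at this
    linarith

lemma side_of_lt_four (h0 : 0 < s) (h1 : s < 1) (h : logOdds s = b * (s - 1 / 2) - c)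
    (hb : b < 4) : c * (s - 1 / 2) ≤ 0 := by
  rcases lt_trichotomy s (1 / 2) with hs | rfl | hs
  · have := lt_logOdds (s := 1 - s) (by linarith) (by linarith)
    rw [logOdds_one_sub, h] at this
    have : 0 < c := by nlinarith
    nlinarith
  · simp
  · have := lt_logOdds hs h1
    rw [h] at this
    have : c < 0 := by nlinarith
    nlinarith

lemma exists_analyticAt (hs : IsFavouredRoot b c s) (hbc : c ≠ 0 ∨ b < 4) :
    ∃ ψ : ℝ × ℝ → ℝ, AnalyticAt ℝ ψ (b, c) ∧ ∀ᶠ v in 𝓝 (b, c), IsFavouredRoot v.1 v.2 (ψ v) := by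
  have hs1 : 1 - s ≠ 0 := by linarith [hs.lt_one]
  let F : (ℝ × ℝ) × ℝ → ℝ := fun u => logOdds u.2 - u.1.1 * (u.2 - 1 / 2) + u.1.2
  have hF : ContDiffAt ℝ ω F ((b, c), s) := by
    have e1 : ContDiffAt ℝ ω (fun u : (ℝ × ℝ) × ℝ => Real.log u.2) ((b, c), s) :=
      contDiffAt_snd.log hs.pos.ne'
    have e2 : ContDiffAt ℝ ω (fun u : (ℝ × ℝ) × ℝ => Real.log (1 - u.2)) ((b, c), s) :=
      (contDiffAt_const.sub contDiffAt_snd).log hs1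
    have e3 : ContDiffAt ℝ ω (fun u : (ℝ × ℝ) × ℝ => u.1.1 * (u.2 - 1 / 2)) ((b, c), s) := by
      fun_prop
    have e4 : ContDiffAt ℝ ω (fun u : (ℝ × ℝ) × ℝ => u.1.2) ((b, c), s) := by fun_prop
    exact ((e1.sub e2).sub e3).add e4
  have hF0 : F ((b, c), s) = 0 := by
    simp only [F, hs.eq]; ring
  have hω : (ω : WithTop ℕ∞) ≠ 0 := by simp
  have hd : HasDerivAt (fun t => F ((b, c), t)) (s⁻¹ + (1 - s)⁻¹ - b) s := by
    have := ((hasDerivAt_logOdds hs.pos hs.lt_one).sub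
      (((hasDerivAt_id s).sub_const (1 / 2)).const_mul b)).add_const c
    simpa [F] using this
  have hd2 : HasDerivAt (fun t => F ((b, c), t))
      ((fderiv ℝ F ((b, c), s) ∘L .inr ℝ (ℝ × ℝ) ℝ) 1) s :=
    ((hF.differentiableAt hω).hasFDerivAt.comp s
      (hasFDerivAt_prodMk_right (𝕜 := ℝ) (b, c) s)).hasDerivAt
  have hne : (fderiv ℝ F ((b, c), s) ∘L .inr ℝ (ℝ × ℝ) ℝ) 1 ≠ 0 := by
    rw [← hd.unique hd2]
    have := hs.lt_deriv hbc
    linarith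
  have hinv : (fderiv ℝ F ((b, c), s) ∘L .inr ℝ (ℝ × ℝ) ℝ).IsInvertible := by
    refine ⟨ContinuousLinearEquiv.unitsEquivAut ℝ (Units.mk0 _ hne), ?_⟩
    ext
    simp
  have hψ := hF.contDiffAt_implicitFunction hω hinv
  have hψ0 : hF.implicitFunction hω hinv (b, c) = s := hF.implicitFunction_apply_self hω hinv
  refine ⟨hF.implicitFunction hω hinv, hψ.analyticAt, ?_⟩
  have hcont : Tendsto (hF.implicitFunction hω hinv) (𝓝 (b, c)) (𝓝 s) := by
    have := hψ.continuousAt.tendsto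
    rwa [hψ0] at this
  have hside : ∀ᶠ v : ℝ × ℝ in 𝓝 (b, c),
      v.2 * (hF.implicitFunction hω hinv v - 1 / 2) < 0 ∨ v.1 < 4 := by
    rcases hbc with hc | hb
    · have h1 : c * (s - 1 / 2) < 0 :=
        lt_of_le_of_ne hs.side (mul_ne_zero hc (sub_ne_zero.2 (hs.ne_half hc)))
      have h2 : Tendsto (fun v : ℝ × ℝ => v.2 * (hF.implicitFunction hω hinv v - 1 / 2))
          (𝓝 (b, c)) (𝓝 (c * (s - 1 / 2))) :=
        (continuous_snd.tendsto (b, c)).mul (hcont.sub_const _)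
      exact (h2.eventually_lt_const h1).mono fun v => Or.inl
    · exact ((continuous_fst.tendsto (b, c)).eventually_lt_const hb).mono fun v => Or.inr
  filter_upwards [hF.eventually_apply_implicitFunction hω hinv,
    hcont.eventually_const_lt hs.pos, hcont.eventually_lt_const hs.lt_one, hside] with v h1 h2 h3 h4
  rw [hF0] at h1
  have h5 : logOdds (hF.implicitFunction hω hinv v) =
      v.1 * (hF.implicitFunction hω hinv v - 1 / 2) - v.2 := by
    simp only [F] at h1
    linarith
  exact ⟨h2, h3, h5, h4.elim le_of_lt (side_of_lt_four h2 h3 h5)⟩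

end IsFavouredRoot

/-- The contribution of a single coordinate, subject to a field `k`, to the free energy. -/
noncomputable def siteEnergy (β k x : ℝ) : ℝ := x * Real.log x - β / 2 * x ^ 2 - k * x

lemma hasDerivAt_siteEnergy (β k : ℝ) {x : ℝ} (hx : x ≠ 0) :
    HasDerivAt (siteEnergy β k) (Real.log x + 1 - β * x - k) x := by
  have h := ((Real.hasDerivAt_mul_log hx).sub ((hasDerivAt_pow 2 x).const_mul (β / 2))).sub
    ((hasDerivAt_id x).const_mul k)
  refine h.congr_deriv ?_
  simp
  ring

lemma strictConcaveOn_siteEnergy {β : ℝ} (hβ : 0 < β) (k : ℝ) :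
    StrictConcaveOn ℝ (Set.Ici β⁻¹) (siteEnergy β k) := by
  have hpos : ∀ x ∈ Set.Ici β⁻¹, 0 < x := fun x hx => (inv_pos.2 hβ).trans_le hx
  refine StrictAntiOn.strictConcaveOn_of_deriv (convex_Ici _) ?_ ?_
  · intro x hx
    exact (hasDerivAt_siteEnergy β k (hpos x hx).ne').continuousAt.continuousWithinAt
  · rw [interior_Ici]
    intro x hx y hy hxy
    have hx0 := hpos x (Set.Ioi_subset_Ici_self hx)
    have hy0 := hpos y (Set.Ioi_subset_Ici_self hy)
    rw [(hasDerivAt_siteEnergy β k hx0.ne').deriv, (hasDerivAt_siteEnergy β k hy0.ne').deriv]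
    have h1 := Real.log_le_sub_one_of_pos (div_pos hy0 hx0)
    rw [Real.log_div hy0.ne' hx0.ne'] at h1
    have h2 : y / x - 1 < β * (y - x) := by
      have hx1 : 1 < x * β := (inv_lt_iff_one_lt_mul₀ hβ).1 hx
      rw [div_sub_one hx0.ne', div_lt_iff₀ hx0]
      nlinarith
    linarith

lemma siteEnergy_add_lt {β ε x : ℝ} (hβ : 0 < β) (k : ℝ) (hε : 0 < ε) (hx : β⁻¹ + ε ≤ x) :
    siteEnergy β k (x + ε) + siteEnergy β k (x - ε) < 2 * siteEnergy β k x := by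
  have h₁ : x + ε ∈ Set.Ici β⁻¹ := Set.mem_Ici.2 (by linarith)
  have h₂ : x - ε ∈ Set.Ici β⁻¹ := Set.mem_Ici.2 (by linarith)
  have hne : x + ε ≠ x - ε := by linarith
  have h := (strictConcaveOn_siteEnergy hβ k).2 h₁ h₂ hne one_half_pos one_half_pos (add_halves 1)
  simp only [smul_eq_mul] at h
  rw [show 1 / 2 * (x + ε) + 1 / 2 * (x - ε) = x by ring] at h
  linarith

/-- The external field acting on the coordinate `i`. -/
noncomputable def siteField {q : ℕ} [NeZero q] (h : ℝ) (i : Fin q) : ℝ := if i = 0 then h else 0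

lemma freeEnergy_eq_sum (q : ℕ) [NeZero q] (β h : ℝ) (x : Fin q → ℝ) :
    freeEnergy q β h x = ∑ i, siteEnergy β (siteField h i) (x i) := by
  simp [freeEnergy, siteEnergy, siteField, Finset.sum_sub_distrib, Finset.mul_sum]

/-- `y` is a global minimizer of the free energy on the simplex. -/
structure IsMinimizer (q : ℕ) [NeZero q] (β h : ℝ) (y : Fin q → ℝ) : Prop where
  mem : y ∈ simplex q
  le : ∀ z ∈ simplex q, freeEnergy q β h y ≤ freeEnergy q β h z

lemma isCompact_simplex (q : ℕ) : IsCompact (simplex q) := isCompact_stdSimplex ℝ (Fin q)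

lemma exists_isMinimizer (q : ℕ) [NeZero q] (β h : ℝ) : ∃ y, IsMinimizer q β h y := by
  have hne : (simplex q).Nonempty := ⟨Pi.single 0 1, single_mem_stdSimplex ℝ 0⟩
  have hc : Continuous (freeEnergy q β h) := by
    unfold freeEnergy
    have := fun i : Fin q => (continuous_apply (A := fun _ => ℝ) i).mul_log
    fun_prop
  obtain ⟨y, hy, hmin⟩ := (isCompact_simplex q).exists_isMinOn hne hc.continuousOn
  exact ⟨y, hy, hmin⟩

namespace IsMinimizer

variable {q : ℕ} [NeZero q] {β h : ℝ} {y : Fin q → ℝ}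

lemma pair_le (hy : IsMinimizer q β h y) {i j : Fin q} (hij : i ≠ j) {a b : ℝ} (ha : 0 ≤ a)
    (hb : 0 ≤ b) (hab : a + b = y i + y j) :
    siteEnergy β (siteField h i) (y i) + siteEnergy β (siteField h j) (y j) ≤
      siteEnergy β (siteField h i) a + siteEnergy β (siteField h j) b := by
  let z : Fin q → ℝ := Function.update (Function.update y i a) j b
  have hzi : z i = a := by simp [z, hij]
  have hzj : z j = b := by simp [z]
  have hzk : ∀ k, k ≠ i ∧ k ≠ j → z k = y k := fun k hk => by simp [z, hk.1, hk.2]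
  have hz : z ∈ simplex q := by
    refine ⟨fun k => ?_, ?_⟩
    · by_cases hki : k = i
      · rw [hki, hzi]; exact ha
      by_cases hkj : k = j
      · rw [hkj, hzj]; exact hb
      rw [hzk k ⟨hki, hkj⟩]
      exact hy.mem.1 k
    · have : ∑ k, (z k - y k) = (z i - y i) + (z j - y j) :=
        Fintype.sum_eq_add i j hij fun k hk => by rw [hzk k hk, sub_self]
      rw [Finset.sum_sub_distrib, hy.mem.2, hzi, hzj] at this
      linarith
  have hle := hy.le z hz
  rw [freeEnergy_eq_sum, freeEnergy_eq_sum, ← sub_nonneg, ← Finset.sum_sub_distrib,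
    Fintype.sum_eq_add i j hij fun k hk => by rw [hzk k hk, sub_self], hzi, hzj] at hle
  linarith

lemma pos (hy : IsMinimizer q β h y) (hβ : 0 ≤ β) (i : Fin q) : 0 < y i := by
  refine lt_of_le_of_ne (hy.mem.1 i) fun hi => ?_
  obtain ⟨j, -, hj⟩ : ∃ j ∈ Finset.univ, 0 < y j := by
    refine Finset.exists_lt_of_sum_lt ?_
    rw [hy.mem.2]
    simp
  have hij : i ≠ j := by
    rintro rfl
    linarith
  set σ := y j
  set r := β * σ + |siteField h i - siteField h j| + 1
  have hr : 0 < r := by positivity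
  set ε := σ * Real.exp (-r)
  have hε : 0 < ε := by positivity
  have hεσ : ε < σ := mul_lt_of_lt_one_right hj (Real.exp_lt_one_iff.2 (by linarith))
  have hlog : Real.log ε = Real.log σ - r := by
    rw [Real.log_mul hj.ne' (Real.exp_pos _).ne', Real.log_exp]
    ring
  have hle := hy.pair_le hij hε.le (sub_pos.2 hεσ).le (by rw [← hi]; ring)
  simp only [← hi, siteEnergy] at hle
  have h1 : (σ - ε) * Real.log (σ - ε) ≤ (σ - ε) * Real.log σ :=
    mul_le_mul_of_nonneg_left (Real.log_le_log (by linarith) (by linarith)) (by linarith)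
  have h2 : -(siteField h i - siteField h j) * ε ≤ |siteField h i - siteField h j| * ε :=
    mul_le_mul_of_nonneg_right (neg_le_abs _) hε.le
  have h3 : 0 ≤ β * ε ^ 2 := by positivity
  have h4 : ε * r = ε * (β * σ + |siteField h i - siteField h j| + 1) := rfl
  rw [hlog] at hle
  nlinarith

lemma critical (hy : IsMinimizer q β h y) (hβ : 0 ≤ β) {i j : Fin q} (hij : i ≠ j) :
    Real.log (y i) - β * y i - siteField h i = Real.log (y j) - β * y j - siteField h j := by
  have hi := hy.pos hβ i
  have hj := hy.pos hβ j
  let f : ℝ → ℝ := fun t =>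
    siteEnergy β (siteField h i) (y i + t) + siteEnergy β (siteField h j) (y j - t)
  have hmin : IsLocalMin f 0 := by
    have h1 : ∀ᶠ t : ℝ in 𝓝 0, -y i < t := eventually_gt_nhds (by linarith)
    have h2 : ∀ᶠ t : ℝ in 𝓝 0, t < y j := eventually_lt_nhds hj
    filter_upwards [h1, h2] with t ht1 ht2
    simpa [f] using hy.pair_le hij (a := y i + t) (b := y j - t) (by linarith) (by linarith)
      (by ring)
  have hd := (HasDerivAt.comp_const_add (y i) 0
    (by simpa using hasDerivAt_siteEnergy β (siteField h i) hi.ne')).add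
    (HasDerivAt.comp_const_sub (y j) 0
      (by simpa using hasDerivAt_siteEnergy β (siteField h j) hj.ne'))
  have := hmin.hasDerivAt_eq_zero hd
  linarith

lemma le_zero (hy : IsMinimizer q β h y) (hh : 0 < h) {j : Fin q} (hj : j ≠ 0) : y j ≤ y 0 := by
  have := hy.pair_le hj.symm (hy.mem.1 j) (hy.mem.1 0) (add_comm _ _)
  simp only [siteEnergy, siteField, if_neg hj, if_true] at this
  nlinarith

lemma not_lt (hy : IsMinimizer q β h y) (hβ : 0 ≤ β) (hh : 0 < h) {i j : Fin q} (hi : i ≠ 0)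
    (hj : j ≠ 0) : ¬ y i < y j := by
  intro hlt
  have hi0 := hy.pos hβ i
  have hj0 := hy.pos hβ j
  have hij : i ≠ j := by
    rintro rfl
    exact lt_irrefl _ hlt
  have hcrit := hy.critical hβ hij
  simp only [siteField, if_neg hi, if_neg hj] at hcrit
  have hβj : 1 < β * y j := by
    have h1 := Real.log_lt_sub_one_of_pos (div_pos hi0 hj0) 
      (by rw [Ne, div_eq_one_iff_eq hj0.ne']; exact hlt.ne)
    rw [Real.log_div hi0.ne' hj0.ne', div_sub_one hj0.ne', lt_div_iff₀ hj0] at h1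
    nlinarith
  have hβ0 : 0 < β := by
    by_contra! hb
    nlinarith
  have hinv : β⁻¹ < y j := (inv_lt_iff_one_lt_mul₀ hβ0).2 (by linarith)
  have hβi : 0 < β⁻¹ := inv_pos.2 hβ0
  have hj1 := hy.le_zero hh hj
  set ε := y j - β⁻¹
  have hε : 0 < ε := sub_pos.2 hinv
  have hεj : β⁻¹ + ε = y j := add_sub_cancel _ _
  have c0 := siteEnergy_add_lt hβ0 (siteField h (0 : Fin q)) hε (hεj.le.trans hj1)
  have cj := siteEnergy_add_lt hβ0 (siteField h j) hε hεj.le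
  have p1 := hy.pair_le hj.symm (a := y 0 + ε) (b := y j - ε) (by linarith) (by linarith) (by ring)
  have p2 := hy.pair_le hj.symm (a := y 0 - ε) (b := y j + ε) (by linarith) (by linarith) (by ring)
  linarith

end IsMinimizer

/-- The vector with first coordinate `s`, the remaining mass being shared equally. -/
noncomputable def profile (q : ℕ) [NeZero q] (s : ℝ) : Fin q → ℝ :=
  fun i => if i = 0 then s else (1 - s) / ((q : ℝ) - 1)

lemma sum_ite_zero (q : ℕ) [NeZero q] (a b : ℝ) :
    ∑ i : Fin q, (if i = 0 then a else b) = a + ((q : ℝ) - 1) * b := by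
  have : ∀ i : Fin q, (if i = 0 then a else b) = (if i = 0 then a - b else 0) + b := by
    intro i
    split_ifs <;> ring
  simp only [this, Finset.sum_add_distrib, Finset.sum_ite_eq', Finset.mem_univ, if_true,
    Finset.sum_const, Finset.card_univ, Fintype.card_fin, nsmul_eq_mul]
  ring

lemma profile_mem_simplex {q : ℕ} [NeZero q] (hq : 2 ≤ q) {s : ℝ} (h0 : 0 ≤ s) (h1 : s ≤ 1) :
    profile q s ∈ simplex q := by
  have hq' : (2 : ℝ) ≤ q := by exact_mod_cast hq
  refine ⟨fun i => ?_, ?_⟩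
  · unfold profile
    split_ifs
    · exact h0
    · exact div_nonneg (by linarith) (by linarith)
  · unfold profile
    rw [sum_ite_zero, mul_div_cancel₀ _ (by linarith)]
    ring

lemma freeEnergy_profile {q : ℕ} [NeZero q] (hq : 2 ≤ q) (β h : ℝ) {s : ℝ} (h1 : s < 1) :
    freeEnergy q β h (profile q s) = s * Real.log s + (1 - s) * Real.log (1 - s) -
      (1 - s) * Real.log ((q : ℝ) - 1) - β / 2 * (s ^ 2 + (1 - s) ^ 2 / ((q : ℝ) - 1)) - h * s := by
  have hq' : (2 : ℝ) ≤ q := by exact_mod_cast hq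
  have hq1 : (q : ℝ) - 1 ≠ 0 := by linarith
  have : ∀ i : Fin q, siteEnergy β (siteField h i) (profile q s i) =
      if i = 0 then siteEnergy β h s else siteEnergy β 0 ((1 - s) / ((q : ℝ) - 1)) := by
    intro i
    simp only [profile, siteField]
    split_ifs <;> rfl
  rw [freeEnergy_eq_sum, Finset.sum_congr rfl fun i _ => this i, sum_ite_zero]
  simp only [siteEnergy]
  rw [Real.log_div (by linarith) hq1]
  field_simp
  ring

/-- The coupling of the Ising model obtained by restricting the free energy to `profile q s`. -/
noncomputable def effCoupling (q : ℕ) (β : ℝ) : ℝ := β * q / ((q : ℝ) - 1)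

/-- The field of the Ising model obtained by restricting the free energy to `profile q s`. -/
noncomputable def effField (q : ℕ) (β h : ℝ) : ℝ :=
  Real.log ((q : ℝ) - 1) - β * ((q : ℝ) - 2) / (2 * ((q : ℝ) - 1)) - h

lemma IsMinimizer.exists_root {q : ℕ} [NeZero q] {β h : ℝ} {y : Fin q → ℝ} (hq : 2 ≤ q)
    (hβ : 0 ≤ β) (hh : 0 < h) (hy : IsMinimizer q β h y) :
    ∃ s, IsFavouredRoot (effCoupling q β) (effField q β h) s ∧ y = profile q s := by
  have hq' : (2 : ℝ) ≤ q := by exact_mod_cast hq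
  have hq1 : (q : ℝ) - 1 ≠ 0 := by linarith
  let j : Fin q := ⟨1, hq⟩
  have hj : j ≠ 0 := by simp [j, Fin.ext_iff]
  have hyj : y = fun i => if i = 0 then y 0 else y j := by
    ext i
    split_ifs with hi
    · rw [hi]
    · exact le_antisymm (_root_.not_lt.1 (hy.not_lt hβ hh hj hi))
        (_root_.not_lt.1 (hy.not_lt hβ hh hi hj))
  have hsum := hy.mem.2
  rw [hyj, sum_ite_zero] at hsum
  have hyjs : y j = (1 - y 0) / ((q : ℝ) - 1) := by
    rw [eq_div_iff hq1]
    linarith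
  have hyp : y = profile q (y 0) := by
    rw [hyjs] at hyj
    exact hyj
  have h0 := hy.pos hβ 0
  have hj0 := hy.pos hβ j
  have h1 : y 0 < 1 := by nlinarith
  refine ⟨y 0, ⟨h0, h1, ?_, ?_⟩, hyp⟩
  · have hc := hy.critical hβ hj
    rw [hyjs, Real.log_div (by linarith) hq1] at hc
    simp only [siteField, if_neg hj, if_true] at hc
    have e : effCoupling q β * (y 0 - 1 / 2) - effField q β h =
        β * y 0 - β * ((1 - y 0) / ((q : ℝ) - 1)) + h - Real.log ((q : ℝ) - 1) := by
      unfold effCoupling effField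
      field_simp
      ring
    rw [e, logOdds]
    linarith
  · have hle := hy.le _ (profile_mem_simplex hq (s := 1 - y 0) (by linarith) (by linarith))
    have hf := congrArg (freeEnergy q β h) hyp
    rw [freeEnergy_profile hq β h h1] at hf
    rw [hf, freeEnergy_profile hq β h (by linarith), sub_sub_cancel] at hle
    have e : effField q β h * (y 0 - 1 / 2) = (y 0 - 1 / 2) * Real.log ((q : ℝ) - 1)
        - β / 4 * ((y 0 ^ 2 + (1 - y 0) ^ 2 / ((q : ℝ) - 1)) -
          ((1 - y 0) ^ 2 + y 0 ^ 2 / ((q : ℝ) - 1))) - h * (y 0 - 1 / 2) := by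
      unfold effField
      field_simp
      ring
    rw [e]
    linarith

lemma effField_ne_zero_or_of_notMem {q : ℕ} (hq : 2 ≤ q) {β h : ℝ} (hh : 0 < h)
    (hp : (β, h) ∉ criticalLine q) : effField q β h ≠ 0 ∨ effCoupling q β ≤ 4 := by
  have hq' : (2 : ℝ) ≤ q := by exact_mod_cast hq
  by_contra! hc
  obtain ⟨hc, hb⟩ := hc
  have hheq : h = Real.log ((q : ℝ) - 1) - β * ((q : ℝ) - 2) / (2 * ((q : ℝ) - 1)) := by
    unfold effField at hc
    linarith
  refine hp ⟨hh.le, ?_, hheq⟩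
  have hq2 : (2 : ℝ) < q := by
    refine lt_of_le_of_ne hq' fun h2 => ?_
    rw [← h2] at hheq
    norm_num at hheq
    linarith
  rw [effCoupling, lt_div_iff₀ (by linarith)] at hb
  change h < _
  rw [hheq, h0]
  refine sub_lt_sub_left ?_ _
  rw [div_lt_div_iff₀ (by linarith) (by linarith)]
  nlinarith

lemma effField_ne_zero_or_of_ne {q : ℕ} (hq : 2 ≤ q) {β h : ℝ} (hh : 0 < h)
    (hp : (β, h) ∉ criticalLine q) (hne : (β, h) ≠ (beta0 q, h0 q)) :
    effField q β h ≠ 0 ∨ effCoupling q β < 4 := by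
  have hq' : (2 : ℝ) ≤ q := by exact_mod_cast hq
  by_contra! hc
  obtain ⟨hc, hb⟩ := hc
  have hb4 := (effField_ne_zero_or_of_notMem hq hh hp).resolve_left (not_not.2 hc)
  have hβ : β = beta0 q := by
    have := le_antisymm hb4 hb
    rw [effCoupling, div_eq_iff (by linarith)] at this
    rw [beta0, eq_div_iff (by linarith), this]
  have hh0 : h = h0 q := by
    have e : h0 q - h = effField q β h := by
      rw [hβ, effField, h0, beta0]
      have : (q : ℝ) - 1 ≠ 0 := by linarith
      field_simp
      ring
    linarith
  exact hne (by rw [hβ, hh0])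

open Classical in
/-- A choice of favoured root (`0` if there is none): the first coordinate of the minimizer. -/
noncomputable def favouredRoot (b c : ℝ) : ℝ :=
  if hs : ∃ s, IsFavouredRoot b c s then hs.choose else 0

lemma IsFavouredRoot.eq_favouredRoot {b c s : ℝ} (hs : IsFavouredRoot b c s)
    (hbc : c ≠ 0 ∨ b ≤ 4) : favouredRoot b c = s := by
  have hex : ∃ s, IsFavouredRoot b c s := ⟨s, hs⟩
  rw [favouredRoot, dif_pos hex]
  exact hex.choose_spec.unique hs hbc

lemma IsFavouredRoot.analyticAt_favouredRoot {b c s : ℝ} (hs : IsFavouredRoot b c s)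
    (hbc : c ≠ 0 ∨ b < 4) : AnalyticAt ℝ (fun v : ℝ × ℝ => favouredRoot v.1 v.2) (b, c) := by
  obtain ⟨ψ, hψ, hroot⟩ := hs.exists_analyticAt hbc
  have hnear : ∀ᶠ v : ℝ × ℝ in 𝓝 (b, c), v.2 ≠ 0 ∨ v.1 ≤ 4 := by
    rcases hbc with hc | hb
    · exact ((continuous_snd.tendsto (b, c)).eventually_ne hc).mono fun v => Or.inl
    · exact ((continuous_fst.tendsto (b, c)).eventually_lt_const hb).mono fun v hv => Or.inr hv.le
  refine hψ.congr ?_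
  filter_upwards [hroot, hnear] with v hv hbc'
  exact (hv.eq_favouredRoot hbc').symm

/-- off the critical line (with `h > 0`) the free energy has a unique
global minimizer, and the minimizer map is real-analytic (coordinatewise) away from
`h_T ∪ {(β_0,h_0)}`. -/
theorem stmt_5 (q : ℕ) [NeZero q] (hq : 2 ≤ q) :
    ∃ m : ℝ × ℝ → (Fin q → ℝ),
      (∀ p : ℝ × ℝ, 0 ≤ p.1 → 0 < p.2 → p ∉ criticalLine q →
        m p ∈ simplex q ∧
        (∀ y ∈ simplex q,
          ((∀ z ∈ simplex q, freeEnergy q p.1 p.2 y ≤ freeEnergy q p.1 p.2 z) ↔ y = m p))) ∧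
      (∀ p : ℝ × ℝ, 0 ≤ p.1 → 0 < p.2 → p ∉ criticalLine q → p ≠ (beta0 q, h0 q) →
        ∀ i : Fin q, AnalyticAt ℝ (fun p' : ℝ × ℝ => m p' i) p) := by
  have key : ∀ β h : ℝ, 0 ≤ β → 0 < h → (β, h) ∉ criticalLine q → ∀ y, IsMinimizer q β h y →
      y = profile q (favouredRoot (effCoupling q β) (effField q β h)) := by
    intro β h hβ hh hp y hy
    obtain ⟨s, hs, rfl⟩ := hy.exists_root hq hβ hh
    rw [hs.eq_favouredRoot (effField_ne_zero_or_of_notMem hq hh hp)]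
  refine ⟨fun p => profile q (favouredRoot (effCoupling q p.1) (effField q p.1 p.2)), ?_, ?_⟩
  · rintro ⟨β, h⟩ hβ hh hp
    obtain ⟨y, hy⟩ := exists_isMinimizer q β h
    have hm := key β h hβ hh hp y hy ▸ hy
    refine ⟨hm.mem, fun z hz => ⟨fun hmin => key β h hβ hh hp z ⟨hz, hmin⟩, ?_⟩⟩
    rintro rfl
    exact hm.le
  · rintro ⟨β, h⟩ hβ hh hp hne i
    obtain ⟨y, hy⟩ := exists_isMinimizer q β h
    obtain ⟨s, hs, -⟩ := hy.exists_root hq hβ hh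
    have h1 := hs.analyticAt_favouredRoot (effField_ne_zero_or_of_ne hq hh hp hne)
    have h2 : AnalyticAt ℝ (fun p : ℝ × ℝ => (effCoupling q p.1, effField q p.1 p.2)) (β, h) := by
      have h3 : AnalyticAt ℝ (fun p : ℝ × ℝ => p.1) (β, h) := analyticAt_fst
      have h4 : AnalyticAt ℝ (fun p : ℝ × ℝ => p.2) (β, h) := analyticAt_snd
      simp only [effCoupling, effField, div_eq_mul_inv]
      fun_prop
    have h3 : AnalyticAt ℝ
        (fun p : ℝ × ℝ => favouredRoot (effCoupling q p.1) (effField q p.1 p.2)) (β, h) :=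
      AnalyticAt.comp (f := fun p : ℝ × ℝ => (effCoupling q p.1, effField q p.1 p.2)) h1 h2
    by_cases hi : i = 0
    · simpa only [profile, if_pos hi] using h3
    · simp only [profile, if_neg hi, div_eq_mul_inv]
      exact (analyticAt_const.sub h3).mul analyticAt_const
end

section
/- If h = 0 and 0 ≤ β < β_c, then the unique global minimizer of f_{β,0} on Ω is the uniform vector (1/q, …, 1/q). -/
open Real Filter Finset

theorem hasSum_log_one_add_sub_log_one_sub {x : ℝ} (hx : 0 ≤ x) (hx1 : x < 1) :
    HasSum (fun k : ℕ => 2 * (1 / (2 * k + 1)) * x ^ (2 * k + 1))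
      (log (1 + x) - log (1 - x)) :=
  hasSum_log_sub_log_of_abs_lt_one (by rwa [abs_of_nonneg hx])

theorem two_mul_le_log_one_add_sub_log_one_sub {x : ℝ} (hx : 0 ≤ x) (hx1 : x < 1) :
    2 * x ≤ log (1 + x) - log (1 - x) := by
  have h := le_hasSum (hasSum_log_one_add_sub_log_one_sub hx hx1) 0
    (fun k _ => by positivity)
  simpa using h

/-- The function `x ↦ (log (1 + x) - log (1 - x)) / x` is monotone, in cross-multiplied form. -/
theorem mul_log_one_add_sub_log_one_sub_le {x y : ℝ} (hx : 0 ≤ x) (hxy : x ≤ y) (hy1 : y < 1) :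
    y * (log (1 + x) - log (1 - x)) ≤ x * (log (1 + y) - log (1 - y)) := by
  have hy := hx.trans hxy
  refine hasSum_le (fun k => ?_)
    ((hasSum_log_one_add_sub_log_one_sub hx (hxy.trans_lt hy1)).mul_left y)
    ((hasSum_log_one_add_sub_log_one_sub hy hy1).mul_left x)
  have h : x ^ (2 * k) ≤ y ^ (2 * k) := pow_le_pow_left₀ hx hxy _
  have h2 : (0 : ℝ) ≤ 2 * (1 / (2 * k + 1)) * (x * y) := by positivity
  have h3 := mul_le_mul_of_nonneg_left h h2
  rw [pow_succ, pow_succ]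
  linarith

theorem log_sub_log_one_sub {a : ℝ} (ha : 0 < a) (ha1 : a < 1) :
    log a - log (1 - a) = log (1 + (2 * a - 1)) - log (1 - (2 * a - 1)) := by
  have h1 : 1 + (2 * a - 1) = 2 * a := by ring
  have h2 : 1 - (2 * a - 1) = 2 * (1 - a) := by ring
  rw [h1, h2, log_mul two_ne_zero ha.ne', log_mul two_ne_zero (by linarith)]
  ring

theorem hasDerivAt_neg_binEntropy_sub_sq (κ : ℝ) {a : ℝ} (ha : 0 < a) (ha1 : a < 1) :
    HasDerivAt (fun a => -binEntropy a - κ * (a - 1 / 2) ^ 2)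
      (log a - log (1 - a) - 2 * κ * (a - 1 / 2)) a := by
  have h := (hasDerivAt_binEntropy ha.ne' ha1.ne).neg.sub
    ((((hasDerivAt_id a).sub_const (1 / 2)).pow 2).const_mul κ)
  refine h.congr_deriv ?_
  simp
  ring

/-- A quadratic upper bound for the binary entropy, touching it at `p` and `1 - p`. -/
theorem binEntropy_le_of_log_sub_log {p κ : ℝ} (hp : 1 / 2 ≤ p) (hp1 : p < 1)
    (hle : ∀ a, 1 / 2 < a → a < p → log a - log (1 - a) ≤ 2 * κ * (a - 1 / 2))
    (hge : ∀ a, p < a → a < 1 → 2 * κ * (a - 1 / 2) ≤ log a - log (1 - a))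
    {a : ℝ} (ha : 0 ≤ a) (ha1 : a ≤ 1) :
    binEntropy a ≤ binEntropy p - κ * ((a - 1 / 2) ^ 2 - (p - 1 / 2) ^ 2) := by
  wlog h : 1 / 2 ≤ a generalizing a
  · have h' := this (a := 1 - a) (by linarith) (by linarith) (by linarith)
    rw [binEntropy_one_sub] at h'
    linarith [show (1 - a - 1 / 2) ^ 2 = (a - 1 / 2) ^ 2 by ring]
  have hc : Continuous (fun a => -binEntropy a - κ * (a - 1 / 2) ^ 2) := by fun_prop
  have key : -binEntropy p - κ * (p - 1 / 2) ^ 2 ≤ -binEntropy a - κ * (a - 1 / 2) ^ 2 := by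
    rcases le_total a p with hap | hap
    · refine antitoneOn_of_hasDerivWithinAt_nonpos (convex_Icc (1 / 2) p) hc.continuousOn
        (f' := fun a => log a - log (1 - a) - 2 * κ * (a - 1 / 2))
        (fun x hx => ?_) (fun x hx => ?_) ⟨h, hap⟩ ⟨hp, le_rfl⟩ hap
      all_goals rw [interior_Icc] at hx
      · exact (hasDerivAt_neg_binEntropy_sub_sq κ (by linarith [hx.1])
          (by linarith [hx.2])).hasDerivWithinAt
      · linarith [hle x hx.1 hx.2]
    · refine monotoneOn_of_hasDerivWithinAt_nonneg (convex_Icc p 1) hc.continuousOn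
        (f' := fun a => log a - log (1 - a) - 2 * κ * (a - 1 / 2))
        (fun x hx => ?_) (fun x hx => ?_) ⟨le_rfl, hp1.le⟩ ⟨hap, ha1⟩ hap
      all_goals rw [interior_Icc] at hx
      · exact (hasDerivAt_neg_binEntropy_sub_sq κ (by linarith [hx.1])
          (by linarith [hx.2])).hasDerivWithinAt
      · linarith [hge x hx.1 hx.2]
  linarith

theorem binEntropy_le_log_two_sub_sq {a : ℝ} (ha : 0 ≤ a) (ha1 : a ≤ 1) :
    binEntropy a ≤ log 2 - 2 * (a - 1 / 2) ^ 2 := by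
  have h := binEntropy_le_of_log_sub_log (p := 1 / 2) (κ := 2) le_rfl (by norm_num)
    (fun a h1 h2 => absurd h1 h2.le.not_gt) (fun a h1 h2 => ?_) ha ha1
  · rw [one_div, binEntropy_two_inv] at h
    rw [one_div]
    linarith
  · rw [log_sub_log_one_sub (by linarith) h2]
    linarith [two_mul_le_log_one_add_sub_log_one_sub (x := 2 * a - 1) (by linarith) (by linarith)]

theorem binEntropy_le_of_half_lt {p : ℝ} (hp : 1 / 2 < p) (hp1 : p < 1)
    {a : ℝ} (ha : 0 ≤ a) (ha1 : a ≤ 1) :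
    binEntropy a ≤ binEntropy p -
      (log p - log (1 - p)) / (2 * p - 1) * ((a - 1 / 2) ^ 2 - (p - 1 / 2) ^ 2) := by
  have hp' : 0 < 2 * p - 1 := by linarith
  have hrw : ∀ b : ℝ, 2 * ((log p - log (1 - p)) / (2 * p - 1)) * (b - 1 / 2) =
      (2 * b - 1) * (log p - log (1 - p)) / (2 * p - 1) := fun b => by
    field_simp
  refine binEntropy_le_of_log_sub_log hp.le hp1 (fun b h1 h2 => ?_) (fun b h1 h2 => ?_) ha ha1
  all_goals
    rw [hrw, log_sub_log_one_sub (a := p) (by linarith) hp1,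
      log_sub_log_one_sub (a := b) (by linarith) (by linarith)]
  · rw [le_div_iff₀ hp']
    linarith [mul_log_one_add_sub_log_one_sub_le (x := 2 * b - 1) (y := 2 * p - 1)
      (by linarith) (by linarith) (by linarith)]
  · rw [div_le_iff₀ hp']
    linarith [mul_log_one_add_sub_log_one_sub_le (x := 2 * p - 1) (y := 2 * b - 1)
      (by linarith) (by linarith) (by linarith)]

theorem antitoneOn_mul_log_sub_quadratic :
    AntitoneOn (fun x : ℝ => x * log x - x + 1 - (x - 1) ^ 2 / 2) (Set.Ici 0) := by
  refine antitoneOn_of_hasDerivWithinAt_nonpos (convex_Ici 0)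
    (f' := fun x => log x - (x - 1)) ?_ (fun x hx => ?_) (fun x hx => ?_)
  · have := continuous_mul_log
    fun_prop
  all_goals rw [interior_Ici] at hx
  · refine HasDerivAt.hasDerivWithinAt ?_
    have h := ((((hasDerivAt_mul_log (ne_of_gt hx)).sub (hasDerivAt_id x)).add_const 1).sub
      ((((hasDerivAt_id x).sub_const 1).pow 2).div_const 2))
    refine h.congr_deriv ?_
    simp
  · linarith [log_le_sub_one_of_pos hx]

theorem antitoneOn_mul_log_div_sq :
    AntitoneOn (fun x : ℝ => (x * log x - x + 1) / (x - 1) ^ 2) (Set.Ioi 1) := by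
  have hd : ∀ x : ℝ, 1 < x → HasDerivAt (fun x : ℝ => (x * log x - x + 1) / (x - 1) ^ 2)
      ((log x * (x - 1) ^ 2 - (x * log x - x + 1) * (2 * (x - 1))) / ((x - 1) ^ 2) ^ 2) x := by
    intro x hx
    have h := (((hasDerivAt_mul_log (x := x) (by linarith)).sub (hasDerivAt_id x)).add_const
      1).div (((hasDerivAt_id x).sub_const 1).pow 2) (pow_ne_zero 2 (by simp; linarith))
    refine h.congr_deriv ?_
    simp
  refine antitoneOn_of_hasDerivWithinAt_nonpos (convex_Ioi 1)
    (fun x hx => (hd x hx).continuousAt.continuousWithinAt)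
    (fun x hx => (hd x (by simpa using hx)).hasDerivWithinAt) (fun x hx => ?_)
  rw [interior_Ioi, Set.mem_Ioi] at hx
  refine div_nonpos_of_nonpos_of_nonneg ?_ (by positivity)
  have h := le_log_one_add_of_nonneg (x := x - 1) (by linarith)
  rw [add_sub_cancel, div_le_iff₀ (by linarith)] at h
  nlinarith

theorem mul_log_sub_mul_sq_le {x b : ℝ} (hx : 0 ≤ x) (hxb : x ≤ b) (hb : 1 < b) :
    (b * log b - b + 1) * (x - 1) ^ 2 ≤ (x * log x - x + 1) * (b - 1) ^ 2 := by
  rcases le_or_gt x 1 with h1 | h1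
  · have hx' := antitoneOn_mul_log_sub_quadratic (Set.mem_Ici.2 hx) (Set.mem_Ici.2 zero_le_one) h1
    have hb' := antitoneOn_mul_log_sub_quadratic (Set.mem_Ici.2 zero_le_one)
      (Set.mem_Ici.2 (hx.trans hxb)) hb.le
    simp only [log_one] at hx' hb'
    have e1 : (b * log b - b + 1) * (x - 1) ^ 2 ≤ (b - 1) ^ 2 / 2 * (x - 1) ^ 2 :=
      mul_le_mul_of_nonneg_right (by linarith) (sq_nonneg _)
    have e2 : (x - 1) ^ 2 / 2 * (b - 1) ^ 2 ≤ (x * log x - x + 1) * (b - 1) ^ 2 :=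
      mul_le_mul_of_nonneg_right (by linarith) (sq_nonneg _)
    linarith
  · have h := antitoneOn_mul_log_div_sq (Set.mem_Ioi.2 h1) (Set.mem_Ioi.2 hb) hxb
    have p1 : 0 < x - 1 := by linarith
    have p2 : 0 < b - 1 := by linarith
    simp only at h
    rwa [div_le_div_iff₀ (by positivity) (by positivity)] at h

theorem mul_log_bregman_mul_sq_le {x a c : ℝ} (hc : 0 < c) (hca : c < a) (hx : 0 ≤ x)
    (hxa : x ≤ a) :
    (a * log a - a * log c - a + c) * (x - c) ^ 2 ≤
      (x * log x - x * log c - x + c) * (a - c) ^ 2 := by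
  have hscale : ∀ y : ℝ, 0 ≤ y →
      y / c * log (y / c) - y / c + 1 = (y * log y - y * log c - y + c) / c := by
    intro y hy
    rcases hy.eq_or_lt with rfl | hy
    · simp [hc.ne']
    · rw [log_div hy.ne' hc.ne']
      field_simp
  have h := mul_log_sub_mul_sq_le (x := x / c) (b := a / c) (by positivity)
    (by gcongr) ((one_lt_div hc).2 hca)
  rw [hscale x hx, hscale a (hx.trans hxa)] at h
  have hs : ∀ y : ℝ, (y / c - 1) ^ 2 = (y - c) ^ 2 / c ^ 2 := fun y => by
    field_simp
  rw [hs, hs, div_mul_div_comm, div_mul_div_comm] at h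
  exact (div_le_div_iff_of_pos_right (by positivity)).1 h

/-- Among probability vectors with prescribed `∑ x_i ^ 2`, the sum `∑ x_i log x_i` is smallest at
the vector with one large coordinate `a` and all the others equal. -/
theorem exists_le_sum_mul_log {q : ℕ} (hq : 2 ≤ q) {x : Fin q → ℝ} (hx : x ∈ simplex q)
    (hxu : x ≠ fun _ => (q : ℝ)⁻¹) :
    ∃ a : ℝ, (q : ℝ)⁻¹ < a ∧ a ≤ 1 ∧
      (∑ i, x i ^ 2) - (q : ℝ)⁻¹ = q / (q - 1) * (a - (q : ℝ)⁻¹) ^ 2 ∧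
      a * log a + (1 - a) * log ((1 - a) / (q - 1)) ≤ ∑ i, x i * log (x i) := by
  obtain ⟨hx0, hx1⟩ := hx
  have hq2 : (2 : ℝ) ≤ q := by exact_mod_cast hq
  have hq0 : (0 : ℝ) < q := by linarith
  have hq1 : (0 : ℝ) < q - 1 := by linarith
  set S := ∑ i, (x i - (q : ℝ)⁻¹) ^ 2 with hS
  have hsq : ∀ c : ℝ, ∑ i, (x i - c) ^ 2 = ∑ i, x i ^ 2 - 2 * c + q * c ^ 2 := by
    intro c
    simp only [sub_sq, Finset.sum_add_distrib, Finset.sum_sub_distrib, ← Finset.sum_mul,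
      ← Finset.mul_sum, hx1]
    simp
  have hS' : S = ∑ i, x i ^ 2 - (q : ℝ)⁻¹ := by
    rw [hS, hsq]
    field_simp
    ring
  have hSpos : 0 < S := by
    obtain ⟨i, hi⟩ := Function.ne_iff.1 hxu
    exact Finset.sum_pos' (fun i _ => sq_nonneg _)
      ⟨i, Finset.mem_univ i, sq_pos_of_ne_zero (sub_ne_zero.2 hi)⟩
  set r := √((q - 1) / q * S) with hr
  have hr0 : 0 < r := Real.sqrt_pos.2 (by positivity)
  have hr2 : r ^ 2 = (q - 1) / q * S := Real.sq_sqrt (by positivity)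
  have hSr : S = q / (q - 1) * r ^ 2 := by
    rw [hr2]
    field_simp
  have hxle1 : ∀ i, x i ≤ 1 := fun i =>
    hx1 ▸ Finset.single_le_sum (fun j _ => hx0 j) (Finset.mem_univ i)
  have hsum1 : ∑ i, x i ^ 2 ≤ 1 := by
    rw [← hx1]
    exact Finset.sum_le_sum fun i _ => by nlinarith [hx0 i, hxle1 i]
  have hxa : ∀ i, x i ≤ (q : ℝ)⁻¹ + r := by
    intro i
    have hd : ∑ j ∈ Finset.univ.erase i, (x j - (q : ℝ)⁻¹) = -(x i - (q : ℝ)⁻¹) := by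
      rw [Finset.sum_erase_eq_sub (Finset.mem_univ i), Finset.sum_sub_distrib, hx1]
      simp [hq0.ne']
    have h := sq_sum_le_card_mul_sum_sq (s := Finset.univ.erase i)
      (f := fun j => x j - (q : ℝ)⁻¹)
    rw [hd, Finset.sum_erase_eq_sub (Finset.mem_univ i), ← hS,
      Finset.card_erase_of_mem (Finset.mem_univ i), Finset.card_univ, Fintype.card_fin,
      Nat.cast_sub (by lia), Nat.cast_one] at h
    have h2 : (x i - (q : ℝ)⁻¹) ^ 2 ≤ r ^ 2 := by
      rw [hr2, div_mul_eq_mul_div, le_div_iff₀ hq0]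
      linarith
    linarith [abs_le_of_sq_le_sq' h2 hr0.le]
  have ha1 : (q : ℝ)⁻¹ + r ≤ 1 := by
    have h : r ^ 2 ≤ (1 - (q : ℝ)⁻¹) ^ 2 := by
      rw [hr2]
      calc (q - 1) / q * S ≤ ((q : ℝ) - 1) / q * (1 - (q : ℝ)⁻¹) := by
            gcongr
            linarith
        _ = _ := by field_simp
    have h1 : (q : ℝ)⁻¹ ≤ 1 := inv_le_one_of_one_le₀ (by linarith)
    linarith [abs_le_of_sq_le_sq' h (by linarith)]
  refine ⟨(q : ℝ)⁻¹ + r, by linarith, ha1, ?_, ?_⟩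
  · rw [← hS', hSr]
    ring
  set a := (q : ℝ)⁻¹ + r with ha
  rcases ha1.eq_or_lt with h1 | h1
  · have hs1 : ∑ i, x i ^ 2 = ∑ i, x i := by
      have hr' : r = 1 - (q : ℝ)⁻¹ := by linarith
      have : ∑ i, x i ^ 2 = q / (q - 1) * (1 - (q : ℝ)⁻¹) ^ 2 + (q : ℝ)⁻¹ := by
        rw [← hr', ← hSr]
        linarith
      rw [this, hx1]
      field_simp
      ring
    have hall := (Finset.sum_eq_sum_iff_of_le (s := Finset.univ) (f := fun i => x i ^ 2)
      (g := x) (fun i _ => by nlinarith [hx0 i, hxle1 i])).1 hs1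
    have hz : ∑ i, x i * log (x i) = 0 := Finset.sum_eq_zero fun i hi => by
      have h := hall i hi
      have h' : x i * (x i - 1) = 0 := by linarith
      rcases mul_eq_zero.1 h' with h | h
      · simp [h]
      · simp [sub_eq_zero.1 h]
    simp [hz, h1]
  · set c := (1 - a) / ((q : ℝ) - 1) with hc
    have hc0 : 0 < c := div_pos (by linarith) hq1
    have hcq : (q - 1) * c = 1 - a := by
      rw [hc]
      field_simp
    have hac : a - c = q / (q - 1) * r := by
      rw [hc, ha]
      field_simp
      ring
    have hac0 : 0 < a - c := hac ▸ by positivity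
    have hsc : ∑ i, (x i - c) ^ 2 = (a - c) ^ 2 := by
      rw [hsq]
      have e1 : ∑ i, x i ^ 2 = q / (q - 1) * r ^ 2 + (q : ℝ)⁻¹ := by linarith
      have e2 : c = (q : ℝ)⁻¹ - r / (q - 1) := by
        rw [hc, ha]
        field_simp
        ring
      rw [e1, hac, e2]
      field_simp
      ring
    have h : ∑ i, (a * log a - a * log c - a + c) * (x i - c) ^ 2 ≤
        ∑ i, (x i * log (x i) - x i * log c - x i + c) * (a - c) ^ 2 :=
      Finset.sum_le_sum fun i _ =>
        mul_log_bregman_mul_sq_le hc0 (by linarith) (hx0 i) (hxa i)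
    rw [← Finset.mul_sum, ← Finset.sum_mul, hsc] at h
    have h' := le_of_mul_le_mul_right h (by positivity)
    simp only [Finset.sum_add_distrib, Finset.sum_sub_distrib, ← Finset.sum_mul, hx1] at h'
    simp only [Finset.sum_const, Finset.card_univ, Fintype.card_fin, nsmul_eq_mul] at h'
    linarith

/-- The mean-field inequality at the critical inverse temperature, for vectors with one
distinguished coordinate `a` and all the others equal. -/
theorem betaC_mul_sq_le {q : ℕ} (hq : 2 ≤ q) {a : ℝ} (ha : 0 ≤ a) (ha1 : a ≤ 1) :
    betaC q / 2 * (q / (q - 1) * (a - (q : ℝ)⁻¹) ^ 2) ≤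
      a * log a + (1 - a) * log ((1 - a) / (q - 1)) + log q := by
  have hent : -binEntropy a = a * log a + (1 - a) * log (1 - a) := by
    rw [binEntropy, log_inv, log_inv]
    ring
  rcases hq.eq_or_lt with rfl | hq
  · have h := binEntropy_le_log_two_sub_sq ha ha1
    norm_num [betaC] at h ⊢
    linarith
  have hq3 : (2 : ℝ) < q := by exact_mod_cast hq
  have hq0 : (0 : ℝ) < q := by linarith
  have hq1 : (0 : ℝ) < q - 1 := by linarith
  have hq2 : (0 : ℝ) < q - 2 := by linarith
  have hlog : (1 - a) * log ((1 - a) / (q - 1)) =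
      (1 - a) * log (1 - a) - (1 - a) * log (q - 1) := by
    rcases ha1.eq_or_lt with rfl | h
    · simp
    · rw [log_div (by linarith) hq1.ne', mul_sub]
  have hp : (1 : ℝ) - (q : ℝ)⁻¹ = (q - 1) / q := by field_simp
  have h := binEntropy_le_of_half_lt (p := 1 - (q : ℝ)⁻¹)
    (by rw [hp, div_lt_div_iff₀] <;> linarith) (by simp [hq0]) ha ha1
  have hE : binEntropy (1 - (q : ℝ)⁻¹) = log q - (1 - (q : ℝ)⁻¹) * log (q - 1) := by
    rw [binEntropy, sub_sub_cancel, inv_inv, log_inv, hp, log_div hq1.ne' hq0.ne']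
    field_simp
    ring
  have hL : log (1 - (q : ℝ)⁻¹) - log (1 - (1 - (q : ℝ)⁻¹)) = log (q - 1) := by
    rw [sub_sub_cancel, log_inv, hp, log_div hq1.ne' hq0.ne']
    ring
  rw [hE, hL] at h
  rw [hlog, betaC, if_neg (by lia)]
  refine le_trans (le_of_eq ?_) (show (a - (q : ℝ)⁻¹) * log (q - 1) +
    log (q - 1) / (2 * (1 - (q : ℝ)⁻¹) - 1) *
      ((a - 1 / 2) ^ 2 - (1 - (q : ℝ)⁻¹ - 1 / 2) ^ 2) ≤ _ by linarith)
  have hden : 2 * (1 - (q : ℝ)⁻¹) - 1 = (q - 2) / q := by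
    field_simp
    ring
  rw [hden]
  field_simp
  ring

theorem freeEnergy_uniform_lt {q : ℕ} [NeZero q] (hq : 2 ≤ q) {β : ℝ} (hβ : β < betaC q)
    {x : Fin q → ℝ} (hx : x ∈ simplex q) (hxu : x ≠ fun _ => (q : ℝ)⁻¹) :
    freeEnergy q β 0 (fun _ => (q : ℝ)⁻¹) < freeEnergy q β 0 x := by
  obtain ⟨a, hqa, ha1, hs, hle⟩ := exists_le_sum_mul_log hq hx hxu
  have hq2 : (2 : ℝ) ≤ q := by exact_mod_cast hq
  have hq0 : (0 : ℝ) < q := by linarith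
  have hq1 : (0 : ℝ) < q - 1 := by linarith
  have hda : 0 < a - (q : ℝ)⁻¹ := sub_pos.2 hqa
  have h := betaC_mul_sq_le hq ((inv_pos.2 hq0).le.trans hqa.le) ha1
  have hpos : 0 < q / (q - 1) * (a - (q : ℝ)⁻¹) ^ 2 := by positivity
  rw [← hs] at h hpos
  have hlt := mul_lt_mul_of_pos_right (div_lt_div_of_pos_right hβ two_pos) hpos
  have hu : freeEnergy q β 0 (fun _ => (q : ℝ)⁻¹) = -log q - β / 2 * (q : ℝ)⁻¹ := by
    simp only [freeEnergy, Finset.sum_const, Finset.card_univ, Fintype.card_fin, nsmul_eq_mul,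
      log_inv]
    field_simp
    ring
  rw [hu, freeEnergy]
  linarith

/-- for `h = 0` and `0 ≤ β < β_c`, the unique global minimizer of
`f_{β,0}` on `Ω` is the uniform vector `(1/q, …, 1/q)`. -/
theorem stmt_7 (q : ℕ) [NeZero q] (hq : 2 ≤ q) (β : ℝ) (hβ : 0 ≤ β) (hβc : β < betaC q) :
    ((fun _ : Fin q => (q : ℝ)⁻¹) ∈ simplex q ∧
      ∀ y ∈ simplex q, freeEnergy q β 0 (fun _ => (q : ℝ)⁻¹) ≤ freeEnergy q β 0 y) ∧
    ∀ x ∈ simplex q, (∀ y ∈ simplex q, freeEnergy q β 0 x ≤ freeEnergy q β 0 y) →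
      x = fun _ => (q : ℝ)⁻¹ := by
  have hq0 : (q : ℝ) ≠ 0 := Nat.cast_ne_zero.2 (NeZero.ne q)
  have hu : (fun _ : Fin q => (q : ℝ)⁻¹) ∈ simplex q := ⟨fun _ => by positivity, by simp [hq0]⟩
  refine ⟨⟨hu, fun y hy => ?_⟩, fun x hx hmin => ?_⟩
  · by_cases h : y = fun _ => (q : ℝ)⁻¹
    · rw [h]
    · exact (freeEnergy_uniform_lt hq hβc hy h).le
  · by_contra h
    exact (hmin _ hu).not_gt (freeEnergy_uniform_lt hq hβc hx h)
end
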